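/- arXiv:2207.09359 — 6 statements merged into one kernel-verified Lean document; each statement's English description precedes it below -/
import Mathlib

section
/- Let R be a commutative ring, let 1 ≤ k ≤ n, and let X ∈ R^{k×n} be a matrix with columns x_1,…,x_n. For any tuple (i_1,…,i_k) of indices from {1,…,n} let p_{i_1,…,i_k} denote the determinant of the k×k matrix whose columns are x_{i_1},…,x_{i_k} in that order. Then for all indices i_1,…,i_{k−1} and j_0,…,j_k in {1,…,n} the Plücker relation holds: ∑_{r=0}^{k} (−1)^r · p_{i_1,…,i_{k−1},j_r} · p_{j_0,…,ĵ_r,…,j_k} = 0, where ĵ_r means the index j_r is omitted. -/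
/-- Plücker relations for the maximal minors of a `k × n` matrix.
For a commutative ring `R`, `1 ≤ k ≤ n`, a matrix `X ∈ R^{k×n}` and
`p (i₁,…,i_k) := det` of the `k×k` matrix with columns `x_{i₁},…,x_{i_k}` (in that order),
the Plücker relation
`∑_{r=0}^{k} (−1)^r p_{i₁,…,i_{k−1},j_r} · p_{j₀,…,ĵ_r,…,j_k} = 0`
holds for all indices `i₁,…,i_{k−1}` and `j₀,…,j_k`. -/
theorem stmt0 {R : Type*} [CommRing R] (k n : ℕ) (hk : 1 ≤ k) (hkn : k ≤ n)
    (X : Matrix (Fin k) (Fin n) R)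
    (p : (Fin k → Fin n) → R)
    (hp : ∀ f : Fin k → Fin n, p f = (X.submatrix id f).det)
    (i : Fin (k - 1) → Fin n) (j : Fin (k + 1) → Fin n) :
    ∑ r : Fin (k + 1), (-1 : R) ^ (r : ℕ) *
        p (fun s : Fin k => if h : (s : ℕ) < k - 1 then i ⟨s, h⟩ else j r) *
        p (j ∘ r.succAbove) = 0 := by
  obtain ⟨m, rfl⟩ : ∃ m, k = m + 1 := ⟨k - 1, by omega⟩
  have key : ∀ t : Fin (m + 1), ∑ r : Fin (m + 1 + 1), (-1 : R) ^ (r : ℕ) * X t (j r) *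
      p (j ∘ r.succAbove) = 0 := by
    intro t
    let M : Matrix (Fin (m + 2)) (Fin (m + 2)) R :=
      Matrix.of (Fin.cons (fun r => X t (j r)) (fun s r => X s (j r)))
    have h0 : M.det = 0 := by
      apply Matrix.det_zero_of_row_eq (i := 0) (j := t.succ) (Fin.succ_ne_zero t).symm
      ext r
      simp [M]
    rw [Matrix.det_succ_row_zero] at h0
    rw [← h0]
    refine Finset.sum_congr rfl fun r _ => ?_
    rw [hp]
    have hM : M.submatrix Fin.succ r.succAbove = X.submatrix id (j ∘ r.succAbove) := by
      ext a b
      simp [M]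
    rw [hM]
    simp [M]
  have expand : ∀ r : Fin (m + 1 + 1),
      p (fun s : Fin (m + 1) => if h : (s : ℕ) < m + 1 - 1 then i ⟨s, h⟩ else j r) =
      ∑ t : Fin (m + 1), ((-1 : R) ^ ((t : ℕ) + m) *
        (X.submatrix t.succAbove (fun s : Fin m => i s)).det) * X t (j r) := by
    intro r
    rw [hp, Matrix.det_succ_column _ (Fin.last m)]
    refine Finset.sum_congr rfl fun t _ => ?_
    rw [Matrix.submatrix_submatrix]
    have hM : (X.submatrix (id ∘ t.succAbove)
        ((fun s : Fin (m + 1) => if h : (s : ℕ) < m + 1 - 1 then i ⟨s, h⟩ else j r) ∘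
          (Fin.last m).succAbove)) = X.submatrix t.succAbove (fun s : Fin m => i s) := by
      ext a b
      simp
    rw [hM]
    simp
    ring
  simp_rw [expand, Finset.mul_sum, Finset.sum_mul]
  rw [Finset.sum_comm]
  refine Finset.sum_eq_zero fun t _ => ?_
  rw [← mul_zero ((-1 : R) ^ ((t : ℕ) + m) *
        (X.submatrix t.succAbove (fun s : Fin m => i s)).det), ← key t, Finset.mul_sum]
  refine Finset.sum_congr rfl fun r _ => ?_
  ring
end

section
/- Let R be a principal ideal domain and let 1 ≤ k ≤ n. Let (p_{i_1,…,i_k}) be a specialization of the coordinate ring A_{k,n} of the Grassmannian Gr(k,n), i.e. an alternating family satisfying the Plücker relations, such that p_{i_1,…,i_k} ∈ R \ {0} for all 1 ≤ i_1 < … < i_k ≤ n. Then there exists a matrix X ∈ R^{k×n} whose columns x_1,…,x_n satisfy det(x_{i_1} ⋯ x_{i_k}) = p_{i_1,…,i_k} for all 1 ≤ i_1 < … < i_k ≤ n; that is, the specialization has a representation over R. -/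
/-- The tuple `(i₁, …, i_{k-1}, x)` used in the first factor of the Plücker relation:
its first `k-1` entries are those of `i` and its last entry is `x`. -/
def pluTuple {n k : ℕ} (i : Fin (k - 1) → Fin n) (x : Fin n) : Fin k → Fin n :=
  fun s => if h : (s : ℕ) < k - 1 then i ⟨s, h⟩ else x

/-- A specialization of the coordinate ring `A_{k,n}` of the Grassmannian `Gr(k,n)` with
values in a commutative ring `R`: a family `p` indexed by `k`-tuples of indices from
`{1,…,n}`, alternating in its indices, and satisfying the Plücker relations. -/
def IsSpecialization {R : Type*} [CommRing R] (k n : ℕ) (p : (Fin k → Fin n) → R) : Prop :=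
  (∀ (f : Fin k → Fin n) (σ : Equiv.Perm (Fin k)),
      p (f ∘ σ) = (Equiv.Perm.sign σ : ℤ) • p f) ∧
  (∀ f : Fin k → Fin n, ¬ Function.Injective f → p f = 0) ∧
  (∀ (i : Fin (k - 1) → Fin n) (j : Fin (k + 1) → Fin n),
      ∑ r : Fin (k + 1), (-1 : R) ^ (r : ℕ) *
        p (pluTuple i (j r)) * p (j ∘ r.succAbove) = 0)

open Matrix in
theorem aux_det_mul {R : Type*} [CommRing R] {k n : ℕ} (X : Matrix (Fin k) (Fin n) R)
    (C : Matrix (Fin n) (Fin k) R) :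
    (X * C).det = ∑ f : Fin k → Fin n, (∏ i, C (f i) i) * (X.submatrix id f).det := by
  have h1 : (X * C).det = Matrix.detRowAlternating
      (fun i : Fin k => ∑ j : Fin n, C j i • (fun s => X s j)) := by
    rw [← Matrix.det_transpose]
    change Matrix.detRowAlternating _ = _
    congr 1
    ext i s
    simp [Matrix.mul_apply, mul_comm]
  rw [h1, ← AlternatingMap.coe_multilinearMap, MultilinearMap.map_sum]
  refine Finset.sum_congr rfl fun f _ => ?_
  rw [MultilinearMap.map_smul_univ, smul_eq_mul, ← Matrix.det_transpose (X.submatrix id f)]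
  rfl

theorem aux_exchange_zero {R : Type*} [CommRing R] {m n : ℕ}
    (p : (Fin (m + 1) → Fin n) → R) (hs : IsSpecialization (m + 1) n p)
    (f0 : Fin (m + 1) → Fin n) (I : Fin m → Fin n) (j : Fin n) :
    p f0 * p (pluTuple (k := m + 1) I j) =
      ∑ s, p (Function.update f0 s j) * p (pluTuple (k := m + 1) I (f0 s)) := by
  have h := hs.2.2 I (Fin.cons j f0)
  rw [Fin.sum_univ_succ] at h
  have h0 : (Fin.cons j f0 : Fin (m + 2) → Fin n) ∘ (0 : Fin (m + 2)).succAbove = f0 := by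
    ext x; simp
  have h2 : ∀ s : Fin (m + 1), p ((Fin.cons j f0 : Fin (m + 2) → Fin n) ∘ s.succ.succAbove)
      = (-1) ^ (s : ℕ) * p (Function.update f0 s j) := by
    intro s
    have e : (Fin.cons j f0 : Fin (m + 2) → Fin n) ∘ s.succ.succAbove
        = Function.update f0 s j ∘ (s.cycleRange).symm := by
      funext x
      refine Fin.cases ?_ (fun y => ?_) x
      · simp
      · simp [Fin.cycleRange_symm_succ]
    rw [e, hs.1]
    simp [Equiv.Perm.sign_symm, Fin.sign_cycleRange]
  simp only [h0, h2, Fin.cons_zero, Fin.cons_succ, Fin.val_zero, pow_zero, one_mul,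
    Fin.val_succ] at h
  have h3 : ∀ s : Fin (m + 1), (-1 : R) ^ ((s : ℕ) + 1) * p (pluTuple (k := m + 1) I (f0 s)) *
      ((-1) ^ (s : ℕ) * p (Function.update f0 s j)) =
      - (p (Function.update f0 s j) * p (pluTuple (k := m + 1) I (f0 s))) := by
    intro s
    have : (-1 : R) ^ (s : ℕ) * (-1) ^ (s : ℕ) = 1 := by
      rw [← mul_pow]; simp
    rw [pow_succ]
    linear_combination (-(p (Function.update f0 s j) * p (pluTuple (k := m + 1) I (f0 s)))) * this
  rw [Finset.sum_congr rfl (fun s _ => h3 s), Finset.sum_neg_distrib] at h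
  linear_combination h

theorem aux_exchange {R : Type*} [CommRing R] {m n : ℕ}
    (p : (Fin (m + 1) → Fin n) → R) (hs : IsSpecialization (m + 1) n p)
    (f0 f : Fin (m + 1) → Fin n) (i : Fin (m + 1)) :
    p f0 * p f =
      ∑ s, p (Function.update f0 s (f i)) * p (Function.update f i (f0 s)) := by
  let τ := Equiv.swap i (Fin.last m)
  let I : Fin m → Fin n := fun x => f (τ x.castSucc)
  have key : ∀ x, p (pluTuple (k := m + 1) I x)
      = ((Equiv.Perm.sign τ : ℤ) : R) * p (Function.update f i x) := by
    intro x
    have e : pluTuple (k := m + 1) I x = Function.update f i x ∘ τ := by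
      funext y
      refine Fin.lastCases ?_ (fun y => ?_) y
      · simp [pluTuple, τ]
      · have hne : τ y.castSucc ≠ i := by
          intro h
          have : y.castSucc = Fin.last m := by
            apply τ.injective; rw [h]; simp [τ]
          exact (Fin.castSucc_lt_last y).ne this
        simp [pluTuple, I, Function.update_of_ne hne]
    rw [e, hs.1, zsmul_eq_mul]
  have h := aux_exchange_zero p hs f0 I (f i)
  simp only [key, Function.update_eq_self] at h
  have hu : ((Equiv.Perm.sign τ : ℤ) : R) * ((Equiv.Perm.sign τ : ℤ) : R) = 1 := by
    rw [← Int.cast_mul, ← Units.val_mul, Int.units_mul_self]; simp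
  have h2 := congrArg (fun z => ((Equiv.Perm.sign τ : ℤ) : R) * z) h
  simp only [Finset.mul_sum] at h2
  calc p f0 * p f = ((Equiv.Perm.sign τ : ℤ) : R) * (p f0 * (((Equiv.Perm.sign τ : ℤ) : R) * p f)) := by
        linear_combination (-(p f0 * p f)) * hu
    _ = _ := h2
    _ = _ := by
        refine Finset.sum_congr rfl fun s _ => ?_
        linear_combination (p (Function.update f0 s (f i)) * p (Function.update f i (f0 s))) * hu

/-- Multilinear extension of `p`. -/
noncomputable def auxPhi {R : Type*} [CommRing R] {k n : ℕ} (p : (Fin k → Fin n) → R) :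
    MultilinearMap R (fun _ : Fin k => Fin n → R) R :=
  ∑ f : Fin k → Fin n, p f •
    (MultilinearMap.mkPiAlgebra R (Fin k) R).compLinearMap (fun i => LinearMap.proj (f i))

theorem auxPhi_apply {R : Type*} [CommRing R] {k n : ℕ} (p : (Fin k → Fin n) → R)
    (f : Fin k → Fin n) :
    auxPhi p (fun i => Pi.single (f i) (1 : R)) = p f := by
  rw [auxPhi, MultilinearMap.sum_apply, Finset.sum_eq_single f]
  · simp
  · intro g _ hg
    obtain ⟨i, hi⟩ := Function.ne_iff.mp hg
    simp only [MultilinearMap.smul_apply, MultilinearMap.compLinearMap_apply,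
      MultilinearMap.mkPiAlgebra_apply, LinearMap.proj_apply, smul_eq_mul]
    rw [Finset.prod_eq_zero (Finset.mem_univ i), mul_zero]
    simp [hi]
  · simp

theorem aux_det {R : Type*} [CommRing R] {m n : ℕ}
    (p : (Fin (m + 1) → Fin n) → R) (hs : IsSpecialization (m + 1) n p)
    (f0 f : Fin (m + 1) → Fin n) :
    p f0 ^ (m + 1) * p f =
      p f0 * (Matrix.of fun s i => p (Function.update f0 s (f i))).det := by
  let L : (Fin n → R) →ₗ[R] (Fin n → R) :=
    (Pi.basisFun R (Fin n)).constr R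
      (fun j => ∑ s, p (Function.update f0 s j) • (Pi.single (f0 s) (1 : R) : Fin n → R))
  have hL : ∀ j, L (Pi.single j 1) =
      ∑ s, p (Function.update f0 s j) • (Pi.single (f0 s) (1 : R) : Fin n → R) := by
    intro j
    have := (Pi.basisFun R (Fin n)).constr_basis R
      (fun j => ∑ s, p (Function.update f0 s j) • (Pi.single (f0 s) (1 : R) : Fin n → R)) j
    rwa [Pi.basisFun_apply] at this
  have step : ∀ (i : Fin (m + 1)) (v : Fin (m + 1) → Fin n → R),
      auxPhi p (Function.update v i (L (v i))) = p f0 * auxPhi p v := by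
    intro i
    have hE : (auxPhi p).compLinearMap
        (Function.update (fun _ : Fin (m + 1) => LinearMap.id) i L) = p f0 • auxPhi p := by
      refine Module.Basis.ext_multilinear (fun _ => Pi.basisFun R (Fin n)) fun g => ?_
      have e : (fun j => (Function.update (fun _ : Fin (m + 1) => LinearMap.id) i L) j
          ((Pi.basisFun R (Fin n)) (g j))) =
          Function.update (fun j => Pi.single (g j) (1 : R)) i (L (Pi.single (g i) 1)) := by
        funext j
        by_cases h : j = i
        · subst h; simp
        · simp [h]
      rw [MultilinearMap.compLinearMap_apply, e, hL, MultilinearMap.map_update_sum]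
      simp only [Pi.basisFun_apply, MultilinearMap.smul_apply, auxPhi_apply, smul_eq_mul,
        MultilinearMap.map_update_smul]
      rw [aux_exchange p hs f0 g i]
      refine Finset.sum_congr rfl fun s _ => ?_
      congr 1
      rw [← auxPhi_apply p (Function.update g i (f0 s))]
      congr 1
      funext j
      by_cases h : j = i
      · subst h; simp
      · simp [h]
    intro v
    have := congrArg (fun F => F v) hE
    simp only [MultilinearMap.compLinearMap_apply, MultilinearMap.smul_apply, smul_eq_mul] at this
    rw [← this]
    congr 1
    funext j
    by_cases h : j = i
    · subst h; simp
    · simp [h]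
  have all : ∀ (S : Finset (Fin (m + 1))) (v : Fin (m + 1) → Fin n → R),
      auxPhi p (fun i => if i ∈ S then L (v i) else v i) = p f0 ^ S.card * auxPhi p v := by
    intro S
    induction S using Finset.induction_on with
    | empty => intro v; simp
    | insert a S ha ih =>
      intro v
      rw [Finset.card_insert_of_notMem ha, pow_succ', mul_assoc, ← ih v, ← step a]
      congr 1
      funext j
      by_cases h : j = a
      · subst h; simp [ha]
      · simp [h]
  have h1 := all Finset.univ (fun i => Pi.single (f i) 1)
  simp only [Finset.mem_univ, if_true, auxPhi_apply, Finset.card_univ, Fintype.card_fin, hL] at h1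
  rw [← h1, MultilinearMap.map_sum]
  have h2 := aux_det_mul (1 : Matrix (Fin (m + 1)) (Fin (m + 1)) R)
    (Matrix.of fun s i => p (Function.update f0 s (f i)))
  rw [Matrix.one_mul] at h2
  rw [h2, Finset.mul_sum]
  refine Finset.sum_congr rfl fun g _ => ?_
  rw [MultilinearMap.map_smul_univ, smul_eq_mul]
  have h3 := auxPhi_apply p (f0 ∘ g)
  simp only [Function.comp_apply] at h3
  have h4 : p (f0 ∘ g) = p f0 *
      ((1 : Matrix (Fin (m + 1)) (Fin (m + 1)) R).submatrix id g).det := by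
    by_cases hg : Function.Injective g
    · have hb := Finite.injective_iff_bijective.mp hg
      have : g = (Equiv.ofBijective g hb : Equiv.Perm (Fin (m + 1))) := rfl
      rw [this, hs.1, Matrix.det_permute']
      simp [mul_comm]
    · rw [hs.2.1 _ (fun h => hg (Function.Injective.of_comp h))]
      simp only [Function.Injective, not_forall] at hg
      obtain ⟨a, b, hab, hne⟩ := hg
      rw [Matrix.det_zero_of_column_eq hne (by intro x; simp only [Matrix.submatrix_apply]; rw [hab]), mul_zero]
  rw [h3, h4]
  simp only [Matrix.of_apply]
  ring

theorem aux_factor {R : Type*} [CommRing R] [IsDomain R] [IsPrincipalIdealRing R] {k n : ℕ}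
    (Y : Matrix (Fin k) (Fin n) R) (f0 : Fin k → Fin n) (h : (Y.submatrix id f0).det ≠ 0) :
    ∃ (B : Matrix (Fin k) (Fin k) R) (X : Matrix (Fin k) (Fin n) R)
      (C : Matrix (Fin n) (Fin k) R), Y = B * X ∧ X * C = 1 := by
  let M := LinearMap.range Y.mulVecLin
  have hle : Module.finrank R M ≤ k := by
    simpa using Submodule.finrank_le M
  have hge : k ≤ Module.finrank R M := by
    have hli : LinearIndependent R (fun i : Fin k => (⟨Y.mulVec (Pi.single (f0 i) 1),
        ⟨_, rfl⟩⟩ : M)) := by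
      have h5 : LinearIndependent R (fun i : Fin k => Y.mulVec (Pi.single (f0 i) 1)) := by
        have := Matrix.linearIndependent_cols_of_det_ne_zero h
        convert this using 1
        funext i s
        simp [Matrix.col]
      exact LinearIndependent.of_comp M.subtype h5
    simpa using hli.fintype_card_le_finrank
  let b : Module.Basis (Fin k) R M :=
    (Module.finBasis R M).reindex (finCongr (le_antisymm hle hge))
  have hb : ∀ i, ∃ c : Fin n → R, Y.mulVec c = (b i : Fin k → R) := fun i => (b i).2
  choose c hc using hb
  let y : Fin n → M := fun j => ⟨Y.mulVec (Pi.single j 1), ⟨_, rfl⟩⟩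
  refine ⟨Matrix.of fun s i => (b i : Fin k → R) s, Matrix.of fun i j => b.repr (y j) i,
    Matrix.of fun j i => c i j, ?_, ?_⟩
  · ext s j
    have h6 := congrArg (fun z : M => (z : Fin k → R) s) (b.sum_repr (y j))
    simp only [Submodule.coe_sum, Submodule.coe_smul, Finset.sum_apply, Pi.smul_apply,
      smul_eq_mul] at h6
    simp only [Matrix.mul_apply, Matrix.of_apply]
    have h7 : (y j : Fin k → R) s = Y s j := by simp [y]
    rw [← h7, ← h6]
    exact Finset.sum_congr rfl fun _ _ => mul_comm _ _
  · ext t i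
    have h8 : b i = ∑ j, c i j • y j := by
      apply Subtype.ext
      rw [← hc i]
      funext s
      simp [y, Matrix.mulVec, dotProduct, mul_comm]
    have h9 := congrArg (fun z => b.repr z t) h8
    simp only [Module.Basis.repr_self, map_sum, map_smul, Finsupp.coe_finset_sum,
      Finset.sum_apply, Finsupp.smul_apply, smul_eq_mul] at h9
    simp only [Matrix.mul_apply, Matrix.of_apply]
    rw [Matrix.one_apply, Finset.sum_congr rfl fun _ _ => mul_comm _ _, ← h9,
      Finsupp.single_apply]
    simp [eq_comm]

/-- Theorem `thm:realization`: over a principal ideal domain `R`, every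
specialization of `A_{k,n}` whose Plücker coordinates on increasing tuples are all
nonzero has a representation `X ∈ R^{k×n}`. -/
theorem stmt1 {R : Type*} [CommRing R] [IsDomain R] [IsPrincipalIdealRing R]
    (k n : ℕ) (hk : 1 ≤ k) (hkn : k ≤ n)
    (p : (Fin k → Fin n) → R) (hspec : IsSpecialization k n p)
    (hne : ∀ f : Fin k → Fin n, StrictMono f → p f ≠ 0) :
    ∃ X : Matrix (Fin k) (Fin n) R,
      ∀ f : Fin k → Fin n, StrictMono f → p f = (X.submatrix id f).det := by
  obtain ⟨m, rfl⟩ : ∃ m, k = m + 1 := ⟨k - 1, by omega⟩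
  have hq := hne (Fin.castLE hkn) (Fin.strictMono_castLE hkn)
  generalize (Fin.castLE hkn) = f0 at hq
  let Y : Matrix (Fin (m + 1)) (Fin n) R := Matrix.of fun s j => p (Function.update f0 s j)
  have hY : ∀ f, (Y.submatrix id f).det = p f0 ^ m * p f := by
    intro f
    have := aux_det p hspec f0 f
    apply mul_left_cancel₀ hq
    rw [← mul_assoc, ← pow_succ', this]
    rfl
  obtain ⟨B, X, C, hBX, hXC⟩ := aux_factor Y f0
    (by rw [hY]; exact mul_ne_zero (pow_ne_zero _ hq) hq)
  have hX : ∀ f, B.det * (X.submatrix id f).det = p f0 ^ m * p f := by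
    intro f
    rw [← hY, ← Matrix.det_mul, hBX]
    rfl
  have hsum := aux_det_mul X C
  rw [hXC, Matrix.det_one] at hsum
  obtain ⟨d, hd⟩ : ∃ d, B.det = p f0 ^ m * d := by
    refine ⟨∑ f : Fin (m + 1) → Fin n, (∏ i, C (f i) i) * p f, ?_⟩
    rw [← mul_one B.det, hsum, Finset.mul_sum, Finset.mul_sum]
    refine Finset.sum_congr rfl fun f _ => ?_
    linear_combination (∏ i, C (f i) i) * hX f
  refine ⟨X.updateRow 0 (d • X 0), fun f _ => ?_⟩
  have e : (X.updateRow 0 (d • X 0)).submatrix id f =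
      (X.submatrix id f).updateRow 0 (d • (X.submatrix id f) 0) := by
    ext s i
    by_cases h : s = 0
    · subst h; simp
    · simp [h]
  rw [e, Matrix.det_updateRow_smul, Matrix.updateRow_eq_self]
  apply mul_left_cancel₀ (pow_ne_zero m hq)
  rw [← hX f, hd, mul_assoc]
end

section
/- Let R be a principal ideal domain and let X = (x_1 ⋯ x_n) ∈ R^{k×n} be a matrix such that for every i = 1,…,n the entries of the column x_i generate the unit ideal of R (i.e. |x_i| = 1). Then for every i ∈ {1,…,n} the ideal of R generated by the minors through column i, namely ( det(x_i x_{i_2} ⋯ x_{i_k}) : 1 ≤ i_2 < … < i_k ≤ n ), equals the ideal generated by all k×k minors, ( det(x_{i_1} ⋯ x_{i_k}) : 1 ≤ i_1 < … < i_k ≤ n ). -/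
open scoped Matrix

/-- Proposition `gcd_cond`: let `R` be a principal ideal domain and
`X = (x₁ ⋯ x_n) ∈ R^{k×n}` such that the entries of each column generate the unit ideal
(`|x_i| = 1`). Then for every column index `i` the ideal generated by the maximal minors
through column `i` equals the ideal generated by all maximal minors. -/
theorem stmt2 {R : Type*} [CommRing R] [IsDomain R] [IsPrincipalIdealRing R]
    (k n : ℕ)
    (X : Matrix (Fin k) (Fin n) R)
    (hcol : ∀ j : Fin n, Ideal.span (Set.range fun i => X i j) = ⊤)
    (i : Fin n) :
    Ideal.span {x : R | ∃ f : Fin k → Fin n, StrictMono f ∧ (∃ r, f r = i) ∧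
        x = (X.submatrix id f).det} =
      Ideal.span {x : R | ∃ f : Fin k → Fin n, StrictMono f ∧
        x = (X.submatrix id f).det} := by
  apply le_antisymm
  · apply Ideal.span_mono
    rintro x ⟨f, hf, -, rfl⟩
    exact ⟨f, hf, rfl⟩
  rw [Ideal.span_le]
  rintro x ⟨f, hf, rfl⟩
  have h1 : (1 : R) ∈ Ideal.span (Set.range fun r => X r i) := by
    rw [hcol i]; trivial
  obtain ⟨a, ha⟩ := Ideal.mem_span_range_iff_exists_fun.1 h1
  have key : ∀ g : Fin k → Fin n, (∃ r, g r = i) →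
      (X.submatrix id g).det ∈ Ideal.span {x : R | ∃ f : Fin k → Fin n, StrictMono f ∧
        (∃ r, f r = i) ∧ x = (X.submatrix id f).det} := by
    rintro g ⟨r, hr⟩
    by_cases hg : Function.Injective g
    · have hm : StrictMono (g ∘ Tuple.sort g) :=
        (Tuple.monotone_sort g).strictMono_of_injective
          (hg.comp (Tuple.sort g).injective)
      have hd : (X.submatrix id (g ∘ Tuple.sort g)).det ∈
          Ideal.span {x : R | ∃ f : Fin k → Fin n, StrictMono f ∧
            (∃ r, f r = i) ∧ x = (X.submatrix id f).det} :=
        Ideal.subset_span ⟨_, hm, ⟨(Tuple.sort g).symm r, by simp [hr]⟩, rfl⟩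
      have he := Matrix.det_permute' (Tuple.sort g) (X.submatrix id g)
      rw [Matrix.submatrix_submatrix] at he
      change (X.submatrix id (g ∘ Tuple.sort g)).det = _ at he
      rw [he] at hd
      rcases Int.units_eq_one_or (Equiv.Perm.sign (Tuple.sort g)) with h | h
      · simpa [h] using hd
      · simpa [h] using hd
    · simp only [Function.Injective, not_forall] at hg
      obtain ⟨p, q, hpq, hne⟩ := hg
      rw [Matrix.det_zero_of_column_eq hne (by intro s; simp [hpq])]
      exact Ideal.zero_mem _
  set A := X.submatrix id f with hA
  have hc := Matrix.mulVec_cramer A (fun r => X r i)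
  have hdet : A.det = ∑ j, (a ᵥ* A) j * (X.submatrix id (Function.update f j i)).det := by
    have h2 : a ⬝ᵥ (A *ᵥ A.cramer (fun r => X r i)) = A.det := by
      rw [hc, dotProduct_smul]
      simp only [dotProduct, ha, smul_eq_mul, mul_one]
    rw [← h2, Matrix.dotProduct_mulVec, dotProduct]
    refine Finset.sum_congr rfl fun j _ => ?_
    rw [Matrix.cramer_apply]
    congr 2
    ext s t
    by_cases h : t = j
    · subst h; simp
    · simp [h, hA]
  rw [hdet]
  exact Ideal.sum_mem _ fun j _ => Ideal.mul_mem_left _ _ (key _ ⟨j, by simp⟩)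
end

section
/- Let R be a principal ideal domain, let 1 ≤ k ≤ n, and let (p_{i_1,…,i_k}) be a specialization of A_{k,n} with p_{i_1,…,i_k} ∈ R \ {0} for all 1 ≤ i_1 < … < i_k ≤ n. Let q ∈ R be a prime element dividing p_{i_1,…,i_k} for all 1 ≤ i_1 < … < i_k ≤ n. If the specialization has a representation X = (x_1 ⋯ x_n) ∈ R^{k×n} with |x_i| = 1 for all i, then it also has a representation X' = (x'_1 ⋯ x'_n) ∈ R^{k×n} with |x'_i| = 1 for all i and such that every entry of the first row of X' lies in the ideal (q). -/
open Matrix in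
lemma aux_dep {F : Type*} [Field F] {k n : ℕ} (Y : Matrix (Fin k) (Fin n) F)
    (hY : ∀ f : Fin k → Fin n, StrictMono f → (Y.submatrix id f).det = 0) :
    ¬ LinearIndependent F Y.row := by
  intro h
  have hr : Y.rank = k := by simpa using h.rank_matrix
  have hs : Submodule.span F (Set.range Y.col) = ⊤ := by
    apply Submodule.eq_top_of_finrank_eq
    rw [← Matrix.rank_eq_finrank_span_cols, hr]; simp
  obtain ⟨κ, a, ha, hsp, hli⟩ := exists_linearIndependent' F Y.col
  have : Fintype κ := Fintype.ofInjective a ha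
  have hc : Fintype.card κ = k := by
    have := finrank_span_eq_card hli
    rw [hsp, hs] at this
    simpa using this.symm
  classical
  let s : Finset (Fin n) := Finset.univ.image a
  have hscard : s.card = k := by
    rw [Finset.card_image_of_injective _ ha, Finset.card_univ, hc]
  let f := s.orderEmbOfFin hscard
  have hf : ∀ j, ∃ x, a x = f j := by
    intro j
    obtain ⟨x, -, hx⟩ := Finset.mem_image.1 (s.orderEmbOfFin_mem hscard j)
    exact ⟨x, hx⟩
  choose g hg using hf
  have hgi : Function.Injective g := fun x y hxy => f.injective (by rw [← hg, ← hg, hxy])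
  have hli2 := hli.comp g hgi
  have hdet := hY f f.strictMono
  have h3 : LinearIndependent F (Y.submatrix id f).col := by
    have h4 : (Y.submatrix id f).col = (Y.col ∘ a) ∘ g := by
      ext j i
      change Y i (f j) = Y i (a (g j))
      rw [hg]
    rw [h4]
    exact hli2
  rw [Matrix.linearIndependent_cols_iff_isUnit, Matrix.isUnit_iff_isUnit_det, hdet] at h3
  exact not_isUnit_zero h3

open Matrix in
lemma aux_mat {R : Type*} [CommRing R] {k : ℕ} (z i : Fin k) (c : Fin k → R) (hc : c i = 1) :
    ∃ (M : Matrix (Fin k) (Fin k) R) (u : R), M.det = 1 ∧ M z = u • c := by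
  classical
  let E : Matrix (Fin k) (Fin k) R := (1 : Matrix (Fin k) (Fin k) R).updateRow i c
  let σ := Equiv.swap z i
  let u : R := ((Equiv.Perm.sign σ : ℤ) : R)
  have hE : E.det = 1 := by
    simp only [E]
    rw [← Matrix.cramer_transpose_apply]
    simp [hc]
  have huu : u * u = 1 := by
    simp only [u]
    rw [← Int.cast_mul, ← Units.val_mul, Int.units_mul_self]; simp
  refine ⟨Matrix.diagonal (Function.update 1 z u) * E.submatrix σ id, u, ?_, ?_⟩
  · rw [Matrix.det_mul, Matrix.det_permute, hE, Matrix.det_diagonal,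
      Finset.prod_update_of_mem (Finset.mem_univ z)]
    simpa [u] using huu
  · ext j
    simp [Matrix.diagonal_mul, E, σ]

/-- Lemma `lem:prow`: let `R` be a PID, `p` a specialization of `A_{k,n}`
with nonzero values on increasing tuples, and `q` a prime element dividing all these
values. If `p` has a representation with all columns of volume `1`, then it has such a
representation in which moreover every entry of the first row lies in the ideal `(q)`. -/
theorem stmt3 {R : Type*} [CommRing R] [IsDomain R] [IsPrincipalIdealRing R]
    (k n : ℕ) (hk : 1 ≤ k) (hkn : k ≤ n)
    (p : (Fin k → Fin n) → R) (hspec : IsSpecialization k n p)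
    (hne : ∀ f : Fin k → Fin n, StrictMono f → p f ≠ 0)
    (q : R) (hq : Prime q)
    (hdvd : ∀ f : Fin k → Fin n, StrictMono f → q ∣ p f)
    (X : Matrix (Fin k) (Fin n) R)
    (hX : ∀ f : Fin k → Fin n, StrictMono f → p f = (X.submatrix id f).det)
    (hXcol : ∀ j : Fin n, Ideal.span (Set.range fun i => X i j) = ⊤) :
    ∃ X' : Matrix (Fin k) (Fin n) R,
      (∀ f : Fin k → Fin n, StrictMono f → p f = (X'.submatrix id f).det) ∧
      (∀ j : Fin n, Ideal.span (Set.range fun i => X' i j) = ⊤) ∧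
      (∀ j : Fin n, X' ⟨0, hk⟩ j ∈ Ideal.span ({q} : Set R)) := by
  have hmax : (Ideal.span ({q} : Set R)).IsMaximal :=
    PrincipalIdealRing.isMaximal_of_irreducible hq.irreducible
  let I := Ideal.span ({q} : Set R)
  letI : Field (R ⧸ I) := Ideal.Quotient.field I
  let φ : R →+* R ⧸ I := Ideal.Quotient.mk I
  have hdep := aux_dep (X.map φ) (by
    intro f hf
    have h1 : (X.map φ).submatrix id f = φ.mapMatrix (X.submatrix id f) := by
      ext; simp
    rw [h1, ← RingHom.map_det, ← hX f hf]
    exact Ideal.Quotient.eq_zero_iff_mem.2 (Ideal.mem_span_singleton.2 (hdvd f hf)))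
  rw [Fintype.not_linearIndependent_iff] at hdep
  obtain ⟨g, hg, i, hi⟩ := hdep
  have hlift : ∀ j, ∃ r : R, φ r = (g i)⁻¹ * g j := fun j =>
    Ideal.Quotient.mk_surjective _
  choose c₀ hc₀ using hlift
  let c := Function.update c₀ i 1
  have hc : ∀ j, φ (c j) = (g i)⁻¹ * g j := by
    intro j
    by_cases h : j = i
    · subst h; simp [c, inv_mul_cancel₀ hi]
    · simp [c, h, hc₀]
  obtain ⟨M, u, hM, hMz⟩ := aux_mat (⟨0, hk⟩ : Fin k) i c (by simp [c])
  refine ⟨M * X, ?_, ?_, ?_⟩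
  · intro f hf
    have h1 : (M * X).submatrix id f = M * X.submatrix id f := by
      ext; simp [Matrix.mul_apply]
    rw [h1, Matrix.det_mul, hM, one_mul, hX f hf]
  · intro j
    rw [eq_top_iff, ← hXcol j, Ideal.span_le]
    rintro _ ⟨a, rfl⟩
    have h2 : X = M.adjugate * (M * X) := by
      rw [← Matrix.mul_assoc, Matrix.adjugate_mul, hM, one_smul, Matrix.one_mul]
    have h3 : X a j = ∑ b, M.adjugate a b * (M * X) b j := by
      conv_lhs => rw [h2]
      rw [Matrix.mul_apply]
    simp only [SetLike.mem_coe]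
    rw [h3]
    exact Ideal.sum_mem _ fun b _ => Ideal.mul_mem_left _ _ (Ideal.subset_span ⟨b, rfl⟩)
  · intro j
    apply Ideal.Quotient.eq_zero_iff_mem.1
    change φ _ = 0
    have hgj : ∑ b, g b * φ (X b j) = 0 := by
      have := congrFun hg j
      simpa [Finset.sum_apply, Matrix.row] using this
    rw [Matrix.mul_apply, map_sum]
    have : ∀ b, φ (M ⟨0, hk⟩ b * X b j) = (φ u * (g i)⁻¹) * (g b * φ (X b j)) := by
      intro b
      rw [hMz, Pi.smul_apply, smul_eq_mul, map_mul, map_mul, hc]; ring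
    rw [Finset.sum_congr rfl fun b _ => this b, ← Finset.mul_sum, hgj, mul_zero]
end

section
/- Let R be a principal ideal domain, let 1 ≤ k ≤ n, let q ∈ R be a prime element such that the residue ring R/(q) is finite with c elements, and let (p_{i_1,…,i_k}) be a specialization of A_{k,n} with p_{i_1,…,i_k} ∈ R \ {0} for all 1 ≤ i_1 < … < i_k ≤ n. Suppose there is an integer m ≥ 0 such that ν_q(p_{i_1,…,i_k}) = m for all 1 ≤ i_1 < … < i_k ≤ n. Then the binomial coefficient C(n, k−1) satisfies C(n, k−1) ≤ (c^k − 1)/(c − 1), the number of one-dimensional subspaces of (R/(q))^k. -/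
theorem pluTuple_injective {n k : ℕ} (i : Fin (k - 1) → Fin n) (hi : Function.Injective i)
    (x : Fin n) (hx : ∀ s, i s ≠ x) : Function.Injective (pluTuple (k := k) i x) := by
  intro a b hab
  unfold pluTuple at hab
  split_ifs at hab with h1 h2 h2
  · have := hi hab
    simp only [Fin.mk.injEq] at this
    exact Fin.ext this
  · exact absurd hab (hx _)
  · exact absurd hab.symm (hx _)
  · apply Fin.ext
    have := a.2
    have := b.2
    omega

theorem pluTuple_not_injective {n k : ℕ} (hk : 1 ≤ k) (i : Fin (k - 1) → Fin n)
    (s : Fin (k - 1)) : ¬ Function.Injective (pluTuple (k := k) i (i s)) := by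
  intro h
  have hs := s.2
  have : (⟨s, by omega⟩ : Fin k) = ⟨k - 1, by omega⟩ := by
    apply h
    simp [pluTuple]
  simp only [Fin.mk.injEq] at this
  omega

/-- The counting argument over a finite field. -/
theorem count_field {F : Type*} [Field F] [Finite F] (k n : ℕ) (hk : 1 ≤ k) (hkn : k ≤ n)
    (u : (Fin k → Fin n) → F)
    (h0 : ∀ f : Fin k → Fin n, ¬ Function.Injective f → u f = 0)
    (h1 : ∀ f : Fin k → Fin n, Function.Injective f → u f ≠ 0)
    (hpl : ∀ (i : Fin (k - 1) → Fin n) (j : Fin (k + 1) → Fin n),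
      ∑ r : Fin (k + 1), (-1 : F) ^ (r : ℕ) *
        u (pluTuple i (j r)) * u (j ∘ r.succAbove) = 0) :
    n.choose (k - 1) ≤ (Nat.card F ^ k - 1) / (Nat.card F - 1) := by
  classical
  let b : Fin k → Fin n := Fin.castLE hkn
  have hb : u b ≠ 0 := h1 b (Fin.castLE_injective hkn)
  -- a linear relation on the basis extends
  have key : ∀ (i i' : Fin (k - 1) → Fin n) (l : F),
      (∀ r, u (pluTuple i (b r)) = l * u (pluTuple i' (b r))) →
      ∀ x, u (pluTuple i x) = l * u (pluTuple i' x) := by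
    intro i i' l h x
    have e1 := hpl i (Fin.cons x b)
    have e2 := hpl i' (Fin.cons x b)
    rw [Fin.sum_univ_succ] at e1 e2
    have hc : (Fin.cons x b : Fin (k + 1) → Fin n) ∘ (0 : Fin (k + 1)).succAbove = b := by
      ext s; simp
    rw [hc] at e1 e2
    simp only [Fin.cons_zero, Fin.cons_succ, Fin.val_zero, pow_zero, one_mul] at e1 e2
    simp only [h] at e1
    have e3 : (u (pluTuple i x) - l * u (pluTuple i' x)) * u b = 0 := by
      have := congrArg (fun t => l * t) e2
      simp only [mul_add, Finset.mul_sum, mul_zero] at this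
      rw [sub_mul, sub_eq_zero]
      rw [← this] at e1
      have e4 : ∀ A B C D : F, A + C = B + D → C = D → A = B := by
        intro A B C D h h'
        subst h'
        exact add_right_cancel h
      rw [mul_assoc]
      refine e4 _ _ _ _ e1 (Finset.sum_congr rfl fun r _ => ?_)
      ring
    rcases mul_eq_zero.1 e3 with h | h
    · exact sub_eq_zero.1 h
    · exact absurd h hb
  let T := {S : Finset (Fin n) // S ∈ Finset.powersetCard (k - 1) Finset.univ}
  have hT : ∀ S : T, S.1.card = k - 1 := fun S => (Finset.mem_powersetCard.1 S.2).2
  let e : T → Fin (k - 1) → Fin n := fun S => S.1.orderEmbOfFin (hT S)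
  have einj : ∀ S, Function.Injective (e S) := fun S => (S.1.orderEmbOfFin (hT S)).injective
  have erange : ∀ S x, (∃ s, e S s = x) ↔ x ∈ S.1 := by
    intro S x
    have := Finset.range_orderEmbOfFin S.1 (hT S)
    rw [← Finset.mem_coe, ← this]
    rfl
  have hin : ∀ (S : T) x, x ∈ S.1 → u (pluTuple (e S) x) = 0 := by
    intro S x hx
    obtain ⟨s, rfl⟩ := (erange S x).2 hx
    exact h0 _ (pluTuple_not_injective hk _ s)
  have hout : ∀ (S : T) x, x ∉ S.1 → u (pluTuple (e S) x) ≠ 0 := by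
    intro S x hx
    exact h1 _ (pluTuple_injective _ (einj S) x fun s hs => hx ((erange S x).1 ⟨s, hs⟩))
  let v : T → Fin k → F := fun S r => u (pluTuple (e S) (b r))
  have hv : ∀ S, v S ≠ 0 := by
    intro S hS
    obtain ⟨x, hx⟩ : ∃ x, x ∉ S.1 := by
      by_contra! hcon
      have : S.1 = Finset.univ := Finset.eq_univ_iff_forall.2 hcon
      have h2 := hT S
      rw [this, Finset.card_univ, Fintype.card_fin] at h2
      omega
    apply hout S x hx
    rw [key (e S) (e S) 0 (fun r => by simpa using congrFun hS r) x, zero_mul]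
  let Φ : T → Projectivization F (Fin k → F) := fun S => Projectivization.mk F (v S) (hv S)
  have hΦ : Function.Injective Φ := by
    intro S S' h
    obtain ⟨a, ha⟩ := (Projectivization.mk_eq_mk_iff' F _ _ (hv S) (hv S')).1 h
    have h2 := key (e S) (e S') a (fun r => (congrFun ha r).symm)
    apply Subtype.ext
    symm
    apply Finset.eq_of_subset_of_card_le
    · intro x hx
      by_contra hxS
      exact hout S x hxS (by rw [h2, hin S' x hx, mul_zero])
    · rw [hT, hT]
  have hcard := Nat.card_le_card_of_injective Φ hΦ
  have hTc : Nat.card T = n.choose (k - 1) := by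
    simp [T]
  rw [hTc] at hcard
  have := Projectivization.card'' F (Fin k → F)
  rw [this, Nat.card_fun, Nat.card_fin] at hcard
  exact hcard

theorem stmt5 {R : Type*} [CommRing R] [IsDomain R] [IsPrincipalIdealRing R]
    (k n : ℕ) (hk : 1 ≤ k) (hkn : k ≤ n)
    (q : R) (hq : Prime q) (hfin : Finite (R ⧸ Ideal.span ({q} : Set R)))
    (c : ℕ) (hc : c = Nat.card (R ⧸ Ideal.span ({q} : Set R)))
    (p : (Fin k → Fin n) → R) (hspec : IsSpecialization k n p)
    (hne : ∀ f : Fin k → Fin n, StrictMono f → p f ≠ 0)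
    (m : ℕ) (hm : ∀ f : Fin k → Fin n, StrictMono f → multiplicity q (p f) = m) :
    n.choose (k - 1) ≤ (c ^ k - 1) / (c - 1) := by
  classical
  obtain ⟨hs, hz, hpl⟩ := hspec
  subst hc
  have hqm : q ^ m ≠ 0 := pow_ne_zero _ hq.ne_zero
  have hinj : ∀ f : Fin k → Fin n, Function.Injective f →
      q ^ m ∣ p f ∧ ¬ q ^ (m + 1) ∣ p f := by
    intro f hf
    have hmono : StrictMono (f ∘ Tuple.sort f) :=
      (Tuple.monotone_sort f).strictMono_of_injective (hf.comp (Tuple.sort f).injective)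
    have hfm : FiniteMultiplicity q (p (f ∘ Tuple.sort f)) :=
      FiniteMultiplicity.of_prime_left hq (hne _ hmono)
    have hmm := hm _ hmono
    have hd : ∀ a, q ^ a ∣ p (f ∘ Tuple.sort f) ↔ q ^ a ∣ p f := by
      intro a
      rw [hs]
      rcases Int.units_eq_one_or (Equiv.Perm.sign (Tuple.sort f)) with h | h <;> simp [h]
    rw [← hd, ← hd, hfm.pow_dvd_iff_le_multiplicity, hfm.pow_dvd_iff_le_multiplicity, hmm]
    omega
  have hall : ∀ f, q ^ m ∣ p f := by
    intro f
    by_cases hf : Function.Injective f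
    · exact (hinj f hf).1
    · rw [hz f hf]; exact dvd_zero _
  choose u hu using hall
  have hmax : (Ideal.span ({q} : Set R)).IsMaximal :=
    PrincipalIdealRing.isMaximal_of_irreducible hq.irreducible
  letI : Field (R ⧸ Ideal.span ({q} : Set R)) := Ideal.Quotient.field _
  refine count_field k n hk hkn (fun f => Ideal.Quotient.mk (Ideal.span {q}) (u f)) ?_ ?_ ?_
  · intro f hf
    have : u f = 0 := by
      have h := hz f hf
      rw [hu] at h
      exact (mul_eq_zero.1 h).resolve_left hqm
    simp [this]
  · intro f hf h
    rw [Ideal.Quotient.eq_zero_iff_mem, Ideal.mem_span_singleton] at h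
    apply (hinj f hf).2
    rw [hu, pow_succ]
    exact mul_dvd_mul_left _ h
  · intro i j
    have h := hpl i j
    have h2 : ∑ r : Fin (k + 1), (-1 : R) ^ (r : ℕ) *
        u (pluTuple i (j r)) * u (j ∘ r.succAbove) = 0 := by
      have h3 : (q ^ m * q ^ m) * ∑ r : Fin (k + 1), (-1 : R) ^ (r : ℕ) *
        u (pluTuple i (j r)) * u (j ∘ r.succAbove) = 0 := by
        rw [← h, Finset.mul_sum]
        refine Finset.sum_congr rfl fun r _ => ?_
        rw [hu (pluTuple i (j r)), hu (j ∘ r.succAbove)]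
        ring
      exact (mul_eq_zero.1 h3).resolve_left (mul_ne_zero hqm hqm)
    have h4 := congrArg (Ideal.Quotient.mk (Ideal.span {q})) h2
    simpa only [map_sum, map_mul, map_pow, map_neg, map_one, map_zero] using h4
end

section
/- Let 1 ≤ k ≤ n and let x_1,…,x_n ∈ ℤ^k be vectors such that |x_i| = 1 (the entries of x_i are coprime) for all i = 1,…,n, and such that det(x_{i_1} ⋯ x_{i_k}) > 0 for all 1 ≤ i_1 < … < i_k ≤ n. Then there exist ℓ ≥ n, vectors y_1,…,y_ℓ ∈ ℤ^k, and indices 1 ≤ i_1 < … < i_n ≤ ℓ such that: (a) y_{i_r} = x_r for all r = 1,…,n; (b) det(y_{j_1} ⋯ y_{j_k}) > 0 for all 1 ≤ j_1 < … < j_k ≤ ℓ; and (c) for every i = 1,…,ℓ, det(y_{[i,i+1,…,i+k−1]}) = 1, where the indices i,i+1,…,i+k−1 are reduced modulo ℓ into {1,…,ℓ} and y_{[i,i+1,…,i+k−1]} denotes the k×k matrix whose columns are the corresponding vectors ordered by their reduced indices in ascending order. In other words, the given frieze with coefficients extends to an SL_k-frieze pattern. -/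
/-- The determinant of the `k × k` matrix whose columns are `v 0, …, v (k-1)`. -/
def colDet {k : ℕ} (v : Fin k → (Fin k → ℤ)) : ℤ :=
  (Matrix.of fun r s => v s r).det

/-- determinant of a list of vectors -/
def ldet {k : ℕ} (l : List (Fin k → ℤ)) : ℤ :=
  if l.length = k then colDet (fun s => l.getD s 0) else 0

theorem ldet_of_ne {k : ℕ} {l : List (Fin k → ℤ)} (h : l.length ≠ k) : ldet l = 0 := by
  simp [ldet, h]

theorem ldet_ofFn {k : ℕ} (v : Fin k → (Fin k → ℤ)) : ldet (List.ofFn v) = colDet v := by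
  simp [ldet, List.getD_eq_getElem?_getD]

theorem ldet_slot {k : ℕ} (l1 l2 : List (Fin k → ℤ)) :
    ∃ f : (Fin k → ℤ) →ₗ[ℤ] ℤ, ∀ v, f v = ldet (l1 ++ v :: l2) := by
  by_cases h : (l1 ++ (0 : Fin k → ℤ) :: l2).length = k
  · have hl : l1.length < k := by simp at h; omega
    refine ⟨(Matrix.detRowAlternating (n := Fin k) (R := ℤ)).toMultilinearMap.toLinearMap
      (fun s => (l1 ++ (0 : Fin k → ℤ) :: l2).getD s 0) ⟨l1.length, hl⟩, fun v => ?_⟩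
    have h' : (l1 ++ v :: l2).length = k := by simpa using h
    rw [ldet, if_pos h', colDet, ← Matrix.det_transpose]
    change Matrix.det _ = _
    congr 1
    ext s r
    simp only [Matrix.transpose_apply, Matrix.of_apply, Function.update_apply]
    split_ifs with hs
    · subst hs; simp
    · have : (s : ℕ) ≠ l1.length := fun e => hs (Fin.ext e)
      simp only [List.getD_eq_getElem?_getD, List.getElem?_append, List.getElem?_cons]
      split_ifs <;> first | rfl | omega
  · refine ⟨0, fun v => ?_⟩
    rw [ldet_of_ne]; · rfl
    simpa using h

theorem ldet_dup {k : ℕ} {l : List (Fin k → ℤ)} (h : ¬ l.Nodup) : ldet l = 0 := by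
  by_cases hl : l.length = k
  · rw [ldet, if_pos hl]
    rw [List.nodup_iff_injective_get, Function.Injective] at h
    push Not at h
    obtain ⟨i, j, hij, hne⟩ := h
    refine Matrix.det_zero_of_column_eq (i := ⟨i, by have := i.2; omega⟩)
      (j := ⟨j, by have := j.2; omega⟩) ?_ ?_
    · intro e; apply hne; apply Fin.ext; simpa using e
    · intro r
      simp only [Matrix.of_apply]
      have := congrFun hij r
      simpa using this
  · exact ldet_of_ne hl

theorem ldet_swap {k : ℕ} (l1 l2 : List (Fin k → ℤ)) (a b : Fin k → ℤ) :
    ldet (l1 ++ a :: b :: l2) = - ldet (l1 ++ b :: a :: l2) := by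
  have hd : ∀ c, ldet (l1 ++ c :: c :: l2) = 0 := fun c => ldet_dup (by
    intro h; have := (List.nodup_append.1 h).2.1; simp at this)
  have h1 := hd (a + b)
  obtain ⟨f, hf⟩ := ldet_slot l1 ((a+b) :: l2)
  obtain ⟨fa, hfa⟩ := ldet_slot (l1 ++ [a]) l2
  obtain ⟨fb, hfb⟩ := ldet_slot (l1 ++ [b]) l2
  rw [← hf, map_add, hf, hf] at h1
  have ea := hfa (a + b)
  have eb := hfb (a + b)
  rw [map_add, hfa, hfa] at ea
  rw [map_add, hfb, hfb] at eb
  simp only [List.append_assoc, List.singleton_append, hd] at ea eb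
  linarith

theorem ldet_move {k : ℕ} (l1 l2 l3 : List (Fin k → ℤ)) (a : Fin k → ℤ) :
    ldet (l1 ++ a :: (l2 ++ l3)) = (-1) ^ l2.length * ldet (l1 ++ (l2 ++ a :: l3)) := by
  induction l2 generalizing l1 with
  | nil => simp
  | cons b l2 ih =>
    have := ih (l1 ++ [b])
    simp only [List.append_assoc, List.singleton_append] at this
    rw [List.cons_append, ldet_swap, this]
    simp [pow_succ]

theorem ldet_perm_aux {k : ℕ} {l l' : List (Fin k → ℤ)} (h : l.Perm l') :
    ∀ pre, (ldet (pre ++ l)).natAbs = (ldet (pre ++ l')).natAbs := by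
  induction h with
  | nil => simp
  | cons x h ih => intro pre; simpa using ih (pre ++ [x])
  | swap x y l => intro pre; rw [ldet_swap]; simp
  | trans _ _ ih1 ih2 => intro pre; rw [ih1, ih2]

theorem ldet_perm_dvd {k : ℕ} {l l' : List (Fin k → ℤ)} (h : l.Perm l') (p : ℕ) :
    (p : ℤ) ∣ ldet l ↔ (p : ℤ) ∣ ldet l' := by
  have := ldet_perm_aux h []
  simp only [List.nil_append] at this
  rw [Int.natCast_dvd, Int.natCast_dvd, this]

theorem ldet_cramer {k : ℕ} {l : List (Fin k → ℤ)} (hl : l.length = k) (v : Fin k → ℤ) :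
    ldet l • v = ∑ i : Fin k, ldet (l.set i v) • l.getD i 0 := by
  have h := Matrix.mulVec_cramer (Matrix.of fun r s : Fin k => l.getD s 0 r) v
  rw [ldet, if_pos hl, colDet, ← h]
  ext r
  simp only [Matrix.mulVec, dotProduct, Finset.sum_apply, Pi.smul_apply, smul_eq_mul]
  refine Finset.sum_congr rfl fun i _ => ?_
  rw [mul_comm, Matrix.cramer_apply]
  simp only [Matrix.of_apply]
  congr 1
  rw [ldet, if_pos (by simpa using hl), colDet]
  congr 1
  ext r s
  simp only [Matrix.updateCol_apply, Matrix.of_apply, List.getD_eq_getElem?_getD, List.getElem?_set]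
  by_cases hs : s = i
  · subst hs; simp [hl]
  · have : (i : ℕ) ≠ s := fun e => hs (Fin.ext e.symm)
    simp [hs, this]

theorem ldet_cramer_map {k : ℕ} {l : List (Fin k → ℤ)} (hl : l.length = k) (v : Fin k → ℤ)
    (f : (Fin k → ℤ) →ₗ[ℤ] ℤ) :
    ldet l * f v = ∑ i : Fin k, ldet (l.set i v) * f (l.getD i 0) := by
  have := congrArg f (ldet_cramer hl v)
  simpa only [map_sum, map_smul, smul_eq_mul] using this

/-- Exchange lemma modulo a prime. -/
theorem ldet_exchange {k : ℕ} {l : List (Fin k → ℤ)} (hl : l.length = k) (v : Fin k → ℤ)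
    (f : (Fin k → ℤ) →ₗ[ℤ] ℤ) (p : ℕ) (h : ¬ (p : ℤ) ∣ ldet l * f v) :
    ∃ l1 c l2, l = l1 ++ c :: l2 ∧ ¬ (p : ℤ) ∣ ldet (l1 ++ v :: l2) ∧ ¬ (p : ℤ) ∣ f c := by
  rw [ldet_cramer_map hl] at h
  have : ∃ i : Fin k, ¬ (p : ℤ) ∣ ldet (l.set i v) * f (l.getD i 0) := by
    by_contra! hc
    exact h (Finset.dvd_sum fun i _ => hc i)
  obtain ⟨i, hi⟩ := this
  have hil : (i : ℕ) < l.length := by have := i.2; omega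
  refine ⟨l.take i, l[(i : ℕ)], l.drop (i + 1), ?_, ?_, ?_⟩
  · simp
  · intro hd; apply hi
    rw [List.set_eq_take_append_cons_drop, if_pos hil]
    exact Dvd.dvd.mul_right hd _
  · intro hd; apply hi
    rw [List.getD_eq_getElem _ _ hil]
    exact Dvd.dvd.mul_left hd _

/-- Three-term Plücker relation. -/
theorem ldet_plucker {k : ℕ} (S : List (Fin k → ℤ)) (t m u y : Fin k → ℤ)
    (hS : S.length + 2 = k) :
    ldet (t :: u :: S) * ldet (m :: y :: S) =
      ldet (m :: u :: S) * ldet (t :: y :: S) + ldet (t :: m :: S) * ldet (u :: y :: S) := by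
  obtain ⟨f, hf⟩ := ldet_slot [] (y :: S)
  simp only [List.nil_append] at hf
  have hl : (t :: u :: S).length = k := by simpa using hS
  have h := ldet_cramer_map hl m f
  obtain ⟨j, rfl⟩ : ∃ j, k = j + 2 := ⟨S.length, hS.symm⟩
  rw [Fin.sum_univ_succ, Fin.sum_univ_succ, Finset.sum_eq_zero] at h
  · simp only [hf, Fin.val_zero, Fin.val_succ, List.set_cons_zero, List.set_cons_succ,
      List.getD_cons_zero, List.getD_cons_succ] at h
    linarith
  · intro i _
    simp only [hf, Fin.val_succ, List.set_cons_succ, List.getD_cons_succ]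
    rw [ldet_dup (l := _ :: y :: S), mul_zero]
    have : (i : ℕ) < S.length := by omega
    rw [List.getD_eq_getElem _ _ this]
    simp

theorem ldet_plucker_sorted {k : ℕ} (P J Q : List (Fin k → ℤ)) (t m u y : Fin k → ℤ)
    (hS : P.length + J.length + Q.length + 2 = k) :
    ldet (P ++ t :: (J ++ u :: Q)) * ldet (P ++ m :: (J ++ (Q ++ [y]))) =
      ldet (P ++ m :: (J ++ u :: Q)) * ldet (P ++ t :: (J ++ (Q ++ [y]))) +
      ldet (P ++ t :: m :: (J ++ Q)) * ldet (P ++ (J ++ u :: (Q ++ [y]))) := by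
  have key := ldet_plucker (P ++ (J ++ Q)) t m u y (by simp; omega)
  -- two insertions in front
  have e1 : ∀ (a b : Fin k → ℤ), ldet (a :: b :: (P ++ (J ++ Q))) =
      (-1) ^ J.length * ldet (P ++ a :: (J ++ b :: Q)) := by
    intro a b
    have h1 := ldet_move [a] (P ++ J) Q b
    have h2 := ldet_move [] P (J ++ b :: Q) a
    simp only [List.append_assoc, List.singleton_append, List.nil_append, List.length_append] at h1 h2
    rw [h1, h2, ← mul_assoc, ← pow_add]
    congr 1
    rw [show P.length + J.length + P.length = J.length + 2 * P.length by ring, pow_add, pow_mul]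
    simp
  have e2 : ∀ (a b : Fin k → ℤ), ldet (a :: b :: (P ++ (J ++ Q))) =
      (-1) ^ (J.length + Q.length) * ldet (P ++ a :: (J ++ (Q ++ [b]))) := by
    intro a b
    have h1 := ldet_move [a] (P ++ (J ++ Q)) [] b
    have h2 := ldet_move [] P (J ++ (Q ++ [b])) a
    simp only [List.append_assoc, List.singleton_append, List.nil_append, List.length_append,
      List.append_nil] at h1 h2
    rw [h1, h2, ← mul_assoc, ← pow_add]
    congr 1
    rw [show P.length + (J.length + Q.length) + P.length = J.length + Q.length + 2 * P.length by ring,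
      pow_add _ _ (2 * _), pow_mul]
    simp
  have e3 : ldet (t :: m :: (P ++ (J ++ Q))) = ldet (P ++ t :: m :: (J ++ Q)) := by
    have h1 := ldet_move [t] P (J ++ Q) m
    have h2 := ldet_move [] P (m :: (J ++ Q)) t
    simp only [List.append_assoc, List.singleton_append, List.nil_append] at h1 h2
    rw [h1, h2, ← mul_assoc, ← pow_add, ← two_mul, pow_mul]
    simp
  have e4 : ldet (u :: y :: (P ++ (J ++ Q))) =
      (-1) ^ Q.length * ldet (P ++ (J ++ u :: (Q ++ [y]))) := by
    have h1 := ldet_move [u] (P ++ (J ++ Q)) [] y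
    have h2 := ldet_move [] (P ++ J) (Q ++ [y]) u
    simp only [List.append_assoc, List.singleton_append, List.nil_append, List.length_append,
      List.append_nil] at h1 h2
    rw [h1, h2, ← mul_assoc, ← pow_add]
    congr 1
    rw [show P.length + (J.length + Q.length) + (P.length + J.length)
      = Q.length + 2 * (P.length + J.length) by ring,
      pow_add _ _ (2 * _), pow_mul]
    simp
  rw [e1 t u, e2 m y, e1 m u, e2 t y, e3, e4, pow_add] at key
  have hJ : ((-1 : ℤ) ^ J.length) * (-1) ^ J.length = 1 := by
    rw [← pow_add, ← two_mul, pow_mul]; simp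
  have hQ : ((-1 : ℤ) ^ Q.length) * (-1) ^ Q.length = 1 := by
    rw [← pow_add, ← two_mul, pow_mul]; simp
  set ε := (-1 : ℤ) ^ J.length
  set δ := (-1 : ℤ) ^ Q.length
  set X := ldet (P ++ t :: (J ++ u :: Q)) * ldet (P ++ m :: (J ++ (Q ++ [y]))) with hX
  set Y := ldet (P ++ m :: (J ++ u :: Q)) * ldet (P ++ t :: (J ++ (Q ++ [y]))) with hY
  set Z := ldet (P ++ t :: m :: (J ++ Q)) * ldet (P ++ (J ++ u :: (Q ++ [y]))) with hZ
  have key' : ε * ε * δ * X = ε * ε * δ * Y + δ * Z := by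
    rw [hX, hY, hZ]; linear_combination key
  linear_combination δ * key' - (X - Y) * (δ * δ) * hJ - (X - Y) * hQ + Z * hQ

/-- all maximal minors of the list are positive -/
def LPos {k : ℕ} (L : List (Fin k → ℤ)) : Prop :=
  ∀ l, l.Sublist L → l.length = k → 0 < ldet l

theorem LPos.mono {k : ℕ} {L L' : List (Fin k → ℤ)} (h : LPos L') (hs : L.Sublist L') : LPos L :=
  fun l hl hk => h l (hl.trans hs) hk

theorem lpos_snoc_aux {k : ℕ} {L : List (Fin k → ℤ)} (hL : LPos L) (y : Fin k → ℤ)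
    (hE : ∀ P M Q, L = P ++ (M ++ Q) → P.length + Q.length + 1 = k →
      0 < ldet (P ++ (Q ++ [y]))) :
    ∀ (N : ℕ) (P R Q J : List (Fin k → ℤ)), L = P ++ (R ++ Q) → J.Sublist R → J.length = N →
      P.length + J.length + Q.length + 1 = k → 0 < ldet (P ++ (J ++ (Q ++ [y]))) := by
  intro N
  induction N with
  | zero =>
    intro P R Q J hPL hJ hN hk
    obtain rfl := List.length_eq_zero_iff.1 hN
    exact hE P R Q hPL (by simpa using hk)
  | succ N ih =>
    intro P R Q J hPL hJ hN hk
    obtain ⟨m, J', rfl⟩ : ∃ m J', J = m :: J' := by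
      cases J with
      | nil => simp at hN
      | cons m J' => exact ⟨m, J', rfl⟩
    simp only [List.length_cons, Nat.add_right_cancel_iff] at hN hk
    cases R with
    | nil => simp at hJ
    | cons t R' =>
      rcases List.sublist_cons_iff.1 hJ with hJ | ⟨r, hr, hJ'⟩
      · -- m :: J' sublist R'
        rcases List.eq_nil_or_concat R' with rfl | ⟨R'', u, rfl⟩
        · simp at hJ
        rw [List.concat_eq_append] at hJ hPL
        obtain ⟨A, B, hAB, hA, hB⟩ := List.sublist_append_iff.1 hJ
        rcases List.sublist_singleton.1 hB with rfl | rfl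
        · rw [List.append_nil] at hAB
          subst hAB
          have hpl := ldet_plucker_sorted P J' Q t m u y (by omega)
          have hJR : J'.Sublist R'' := (List.sublist_cons_self m J').trans hA
          have s1 : 0 < ldet (P ++ t :: (J' ++ u :: Q)) := by
            apply hL
            · rw [hPL]
              refine List.Sublist.append (List.Sublist.refl P) ?_
              rw [List.cons_append, List.append_assoc]
              exact (hJR.append (List.Sublist.refl _)).cons_cons t
            · simp; omega
          have s2 : 0 < ldet (P ++ m :: (J' ++ u :: Q)) := by
            apply hL
            · rw [hPL]
              refine List.Sublist.append (List.Sublist.refl P) ?_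
              rw [List.cons_append, List.append_assoc]
              exact (hA.append (List.Sublist.refl (u :: Q))).cons t
            · simp; omega
          have s3 : 0 < ldet (P ++ t :: m :: (J' ++ Q)) := by
            apply hL
            · rw [hPL]
              refine List.Sublist.append (List.Sublist.refl P) ?_
              rw [List.cons_append, List.append_assoc]
              exact (hA.append (List.sublist_append_right [u] Q)).cons_cons t
            · simp; omega
          have r1 := ih (P ++ [t]) (R'' ++ [u]) Q J' (by simpa using hPL)
            (hJR.trans (List.sublist_append_left _ _)) hN (by simp; omega)
          have r2 := ih P (t :: R'') (u :: Q) J' (by simpa using hPL)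
            (hJR.trans (List.sublist_cons_self _ _)) hN (by simp; omega)
          simp only [List.append_assoc, List.cons_append] at r1 r2 ⊢
          have : 0 < ldet (P ++ t :: (J' ++ u :: Q)) * ldet (P ++ m :: (J' ++ (Q ++ [y]))) := by
            rw [hpl]; positivity
          exact pos_of_mul_pos_right this s1.le
        · -- last of J is u
          have hlen : A.length = N := by
            have := congrArg List.length hAB
            simp at this; omega
          have := ih P (t :: R'') (u :: Q) A (by simpa using hPL)
            (hA.trans (List.sublist_cons_self _ _)) hlen (by simp; omega)
          rw [hAB]
          simpa using this
      · obtain ⟨rfl, rfl⟩ := List.cons_eq_cons.1 hr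
        have := ih (P ++ [m]) R' Q J' (by simpa using hPL) hJ' hN (by simp; omega)
        simpa using this

theorem lpos_snoc {k : ℕ} {L : List (Fin k → ℤ)} (hL : LPos L) (y : Fin k → ℤ)
    (hE : ∀ P M Q, L = P ++ (M ++ Q) → P.length + Q.length + 1 = k →
      0 < ldet (P ++ (Q ++ [y]))) : LPos (L ++ [y]) := by
  intro l hl hk
  obtain ⟨A, B, rfl, hA, hB⟩ := List.sublist_append_iff.1 hl
  rcases List.sublist_singleton.1 hB with rfl | rfl
  · rw [List.append_nil] at hk ⊢
    exact hL _ hA hk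
  · have := lpos_snoc_aux hL y hE A.length [] L [] A (by simp) hA rfl (by simpa using hk)
    simpa using this

/-- saturated families: independent modulo every prime -/
def Sat {k : ℕ} (A : List (Fin k → ℤ)) : Prop :=
  ∀ p : ℕ, p.Prime → ∃ C, ¬ (p : ℤ) ∣ ldet (C ++ A)

theorem Sat.mono {k : ℕ} {A B : List (Fin k → ℤ)} (h : Sat B) (hs : A.Sublist B) : Sat A := by
  intro p hp
  obtain ⟨C, hC⟩ := h p hp
  obtain ⟨E, hE⟩ := hs.exists_perm_append
  refine ⟨C ++ E, fun hd => hC ?_⟩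
  rw [ldet_perm_dvd (l' := C ++ E ++ A)]
  · exact hd
  · rw [List.append_assoc]
    exact (hE.trans List.perm_append_comm).append_left C

theorem sat_of_ldet_one {k : ℕ} {A : List (Fin k → ℤ)} (h : ldet A = 1) : Sat A := by
  intro p hp
  refine ⟨[], ?_⟩
  rw [List.nil_append, h]
  intro hd
  exact hp.one_lt.ne' (by exact_mod_cast Int.eq_one_of_dvd_one (by positivity) hd)

theorem sat_singleton {k : ℕ} (x : Fin k → ℤ) (h : Finset.univ.gcd x = 1) : Sat [x] := by
  intro p hp
  have : ∃ r, ¬ (p : ℤ) ∣ x r := by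
    by_contra! hc
    have : (p : ℤ) ∣ Finset.univ.gcd x := Finset.dvd_gcd fun r _ => hc r
    rw [h] at this
    exact hp.one_lt.ne' (by exact_mod_cast Int.eq_one_of_dvd_one (by positivity) this)
  obtain ⟨r, hr⟩ := this
  have h1 : ldet (List.ofFn fun s : Fin k => (Pi.single s 1 : Fin k → ℤ)) = 1 := by
    rw [ldet_ofFn, colDet]
    convert Matrix.det_one (n := Fin k) (R := ℤ)
    ext i j
    simp [Matrix.one_apply, Pi.single_apply]
  obtain ⟨l1, c, l2, _, hd, _⟩ := ldet_exchange
    (l := List.ofFn fun s : Fin k => (Pi.single s 1 : Fin k → ℤ)) (by simp) x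
    (LinearMap.proj r) p (by rw [h1]; simpa using hr)
  refine ⟨l1 ++ l2, fun hdd => hd ?_⟩
  rw [ldet_perm_dvd (l' := l1 ++ l2 ++ [x])]
  · exact hdd
  · rw [List.append_assoc]
    exact (List.perm_append_singleton x l2).symm.append_left l1

theorem sat_snoc {k : ℕ} {F : List (Fin k → ℤ)} (hF : Sat F) (y : Fin k → ℤ)
    (φ : (Fin k → ℤ) →ₗ[ℤ] ℤ) (h0 : ∀ v ∈ F, φ v = 0) (h1 : φ y = 1) : Sat (F ++ [y]) := by
  intro p hp
  obtain ⟨C, hC⟩ := hF p hp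
  have hlen : (C ++ F).length = k := by
    by_contra hne
    rw [ldet_of_ne hne] at hC
    simp at hC
  obtain ⟨l1, c, l2, hl, hd, hc⟩ := ldet_exchange hlen y φ p (by rw [h1, mul_one]; exact hC)
  have hsub : ∃ E, (l1 ++ y :: l2).Perm (E ++ (F ++ [y])) := by
    rcases List.append_eq_append_iff.1 hl with ⟨as, rfl, rfl⟩ | ⟨cs, rfl, hcs⟩
    · exfalso
      apply hc
      rw [h0 c (by simp)]
      simp
    · cases cs with
      | nil =>
        exfalso
        apply hc
        rw [List.nil_append] at hcs
        rw [h0 c (by simp [← hcs])]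
        simp
      | cons a cs =>
        rw [List.cons_append, List.cons_eq_cons] at hcs
        obtain ⟨rfl, rfl⟩ := hcs
        refine ⟨l1 ++ cs, ?_⟩
        rw [List.append_assoc]
        refine List.Perm.append_left l1 ?_
        rw [← List.append_assoc]
        exact (List.perm_append_singleton y _).symm
  obtain ⟨E, hE⟩ := hsub
  exact ⟨E, fun hdd => hd ((ldet_perm_dvd hE p).2 hdd)⟩

/-- the (sorted) cyclic window consisting of the first `i` and the last `k - i` vectors -/
def W {k : ℕ} (i : ℕ) (L : List (Fin k → ℤ)) : ℤ :=
  ldet (L.take i ++ L.drop (L.length - k + i))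

theorem W_snoc {k : ℕ} {i : ℕ} {L : List (Fin k → ℤ)} (hk : k ≤ L.length) (hi : i < k)
    (v : Fin k → ℤ) :
    W i (L ++ [v]) = ldet (L.take i ++ (L.drop (L.length - k + i + 1) ++ [v])) := by
  rw [W, List.take_append_of_le_length (by omega), List.length_append, List.length_singleton,
    show L.length + 1 - k + i = L.length - k + i + 1 by omega,
    List.drop_append_of_le_length (by omega)]

theorem W_pos {k : ℕ} {i : ℕ} {L : List (Fin k → ℤ)} (hk : k ≤ L.length) (hi : i ≤ k)
    (hL : LPos L) : 0 < W i L := by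
  apply hL
  · have h1 : (L.drop (L.length - k + i)).Sublist (L.drop i) :=
      List.drop_sublist_drop_left L (by omega)
    have := (List.Sublist.refl (L.take i)).append h1
    rwa [List.take_append_drop] at this
  · simp; omega

theorem exists_step {k : ℕ} {L : List (Fin k → ℤ)} (h1 : 1 ≤ k) (hk : k ≤ L.length)
    (hL : LPos L) :
    ∃ (y : Fin k → ℤ) (φ : (Fin k → ℤ) →ₗ[ℤ] ℤ) (g : ℤ), LPos (L ++ [y]) ∧
      (∀ i, 1 ≤ i → i < k → W i (L ++ [y]) ≤ W i L) ∧ φ y = 1 ∧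
      (∀ v ∈ L.drop (L.length - k + 1), φ v = 0) ∧ 0 < g ∧
      ∀ v, W 0 (L ++ [v]) = g * φ v := by
  have hslot : ∀ i : ℕ, ∃ f : (Fin k → ℤ) →ₗ[ℤ] ℤ, ∀ v, f v =
      ldet (L.take i ++ (L.drop (L.length - k + i + 1) ++ [v])) := by
    intro i
    obtain ⟨f, hf⟩ := ldet_slot (L.take i ++ L.drop (L.length - k + i + 1)) []
    exact ⟨f, fun v => by rw [hf]; simp⟩
  choose F hF using hslot
  have hFW : ∀ i, i < k → ∀ v, F i v = W i (L ++ [v]) := fun i hi v => by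
    rw [hF, W_snoc hk hi]
  -- values
  have hzero : ∀ i, ∀ v ∈ L.drop (L.length - k + i + 1), F i v = 0 := by
    intro i v hv
    rw [hF]
    apply ldet_dup
    intro hn
    have := (List.nodup_append.1 hn).2.1
    exact (List.nodup_append.1 this).2.2 v hv v (by simp) rfl
  have hval : ∀ i, ∀ (hi : i < k), ∃ ε : ℤ, ε * ε = 1 ∧
      F i (L[L.length - k + i]'(by omega)) = ε * W i L := by
    intro i hi
    refine ⟨(-1) ^ (L.drop (L.length - k + i + 1)).length, ?_, ?_⟩
    · rw [← pow_add, ← two_mul, pow_mul]; simp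
    · have hm := ldet_move (L.take i) (L.drop (L.length - k + i + 1)) []
        (L[L.length - k + i]'(by omega))
      rw [List.append_nil, ← List.drop_eq_getElem_cons, ← hF] at hm
      rw [W, hm, ← mul_assoc, ← pow_add, ← two_mul, pow_mul]
      simp
  -- the content
  obtain ⟨g0, hg0⟩ := (inferInstance : (LinearMap.range (F 0)).IsPrincipal)
  have hdvd : ∀ v, g0 ∣ F 0 v := by
    intro v
    have : F 0 v ∈ LinearMap.range (F 0) := ⟨v, rfl⟩
    rw [hg0, Submodule.mem_span_singleton] at this
    obtain ⟨a, ha⟩ := this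
    exact ⟨a, by rw [← ha]; simp [mul_comm]⟩
  have hgne : g0 ≠ 0 := by
    rintro rfl
    obtain ⟨ε, hε, hv⟩ := hval 0 (by omega)
    have := hdvd (L[L.length - k + 0]'(by omega))
    rw [hv, zero_dvd_iff] at this
    have hW := W_pos hk (Nat.zero_le k) hL
    rcases mul_eq_zero.1 this with h | h
    · rw [h] at hε; simp at hε
    · omega
  have hgpos : 0 < |g0| := abs_pos.2 hgne
  have hdvd' : ∀ v, |g0| ∣ F 0 v := fun v => (abs_dvd _ _).2 (hdvd v)
  obtain ⟨y0, hy0⟩ : ∃ y0, F 0 y0 = |g0| := by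
    have : |g0| ∈ LinearMap.range (F 0) := by
      rw [hg0, Submodule.mem_span_singleton]
      rcases abs_choice g0 with h | h
      · exact ⟨1, by rw [h]; simp⟩
      · exact ⟨-1, by rw [h]; simp⟩
    exact this
  let φ : (Fin k → ℤ) →ₗ[ℤ] ℤ :=
    { toFun := fun v => F 0 v / |g0|
      map_add' := fun u v => by rw [map_add, Int.add_ediv_of_dvd_left (hdvd' u)]
      map_smul' := fun c v => by
        rw [map_smul, smul_eq_mul, Int.mul_ediv_assoc _ (hdvd' v)]; rfl }
  have hφ : ∀ v, F 0 v = |g0| * φ v := fun v => (Int.mul_ediv_cancel' (hdvd' v)).symm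
  -- choose y
  have hy : ∀ i, i < k → ∃ y, F 0 y = |g0| ∧
      ∀ j, 1 ≤ j → j ≤ i → 0 < F j y ∧ F j y ≤ W j L := by
    intro i
    induction i with
    | zero => intro _; exact ⟨y0, hy0, fun j h1 h2 => by omega⟩
    | succ i ih =>
      intro hi
      obtain ⟨y, hy, hyj⟩ := ih (by omega)
      obtain ⟨ε, hε, hv⟩ := hval (i + 1) hi
      have hlt : L.length - k + (i + 1) < L.length := by omega
      set a := L[L.length - k + (i + 1)]'hlt with ha
      have hmem : ∀ j, j ≤ i → a ∈ L.drop (L.length - k + j + 1) := by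
        intro j hj
        rw [List.mem_iff_getElem]
        refine ⟨i - j, by simp; omega, ?_⟩
        rw [List.getElem_drop, ha]
        congr 1; omega
      have hW := W_pos hk hi.le hL
      set w := W (i + 1) L with hw
      set e := F (i + 1) y with he
      refine ⟨y + (-(ε * ((e - 1) / w))) • a, ?_, ?_⟩
      · rw [map_add, map_smul, hzero 0 a (hmem 0 (by omega)), hy]; simp
      · intro j hj1 hj2
        rcases Nat.lt_or_ge i j with hij | hij
        · obtain rfl : j = i + 1 := by omega
          have : F (i + 1) (y + (-(ε * ((e - 1) / w))) • a) = 1 + (e - 1) % w := by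
            rw [map_add, map_smul, hv, ← he, smul_eq_mul, Int.emod_def]
            linear_combination (-((e - 1) / w) * w) * hε
          rw [this]
          have h3 := Int.emod_nonneg (e - 1) hW.ne'
          have h4 := Int.emod_lt_of_pos (e - 1) hW
          constructor <;> omega
        · rw [map_add, map_smul, hzero j a (hmem j hij), smul_zero, add_zero]
          exact hyj j hj1 hij
  obtain ⟨y, hy, hyj⟩ := hy (k - 1) (by omega)
  have hφy : φ y = 1 := by
    have := hφ y
    rw [hy] at this
    exact (mul_left_cancel₀ hgpos.ne' (by rw [mul_one]; exact this)).symm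
  refine ⟨y, φ, |g0|, ?_, ?_, hφy, ?_, hgpos, ?_⟩
  · apply lpos_snoc hL
    intro P M Q hPQ hlen
    have hlen2 := congrArg List.length hPQ
    simp only [List.length_append] at hlen2
    have e1 : L.take P.length = P := by rw [hPQ]; simp
    have e2 : L.drop (L.length - k + P.length + 1) = Q := by
      rw [show L.length - k + P.length + 1 = (P ++ M).length by simp; omega, hPQ,
        ← List.append_assoc, List.drop_left]
    have : F P.length y = ldet (P ++ (Q ++ [y])) := by rw [hF, e1, e2]
    rw [← this]
    rcases Nat.eq_zero_or_pos P.length with h | h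
    · rw [h, hy]; exact hgpos
    · exact (hyj _ h (by omega)).1
  · intro i hi1 hi2
    rw [← hFW i hi2]
    exact (hyj i hi1 (by omega)).2
  · intro v hv
    have := hφ v
    rw [hzero 0 v hv] at this
    rcases mul_eq_zero.1 this.symm with h | h
    · omega
    · exact h
  · intro v
    rw [← hFW 0 (by omega), hφ]

theorem step_one {k : ℕ} {L : List (Fin k → ℤ)} (h1 : 1 ≤ k) (hk : k ≤ L.length)
    (hs : Sat (L.drop (L.length - k + 1))) (φ : (Fin k → ℤ) →ₗ[ℤ] ℤ) (g : ℤ) (hg : 0 < g)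
    (hW : ∀ v, W 0 (L ++ [v]) = g * φ v) : g = 1 := by
  by_contra hne
  obtain ⟨p, hp, hpd⟩ := Nat.exists_prime_and_dvd (n := g.natAbs) (by omega)
  obtain ⟨C, hC⟩ := hs p hp
  have hlen : (C ++ L.drop (L.length - k + 1)).length = k := by
    by_contra hne
    rw [ldet_of_ne hne] at hC
    simp at hC
  obtain ⟨c, rfl⟩ : ∃ c, C = [c] := by
    rw [← List.length_eq_one_iff]
    simp at hlen; omega
  apply hC
  rw [ldet_perm_dvd (l' := L.drop (L.length - k + 1) ++ [c])]
  · have := hW c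
    rw [W_snoc hk (by omega)] at this
    simp only [List.take_zero, List.nil_append, Nat.add_zero] at this
    rw [this]
    exact Dvd.dvd.mul_right (Int.natCast_dvd.2 hpd) _
  · exact (List.perm_append_singleton c _).symm

/-- all linear windows have determinant one -/
def Win {k : ℕ} (L : List (Fin k → ℤ)) : Prop :=
  ∀ S, S <:+: L → S.length = k → ldet S = 1

theorem win_snoc {k : ℕ} {K : List (Fin k → ℤ)} {y : Fin k → ℤ} (h1 : 1 ≤ k) (hK : Win K)
    (h : ∀ t, t <:+ K → t.length + 1 = k → ldet (t ++ [y]) = 1) : Win (K ++ [y]) := by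
  intro S hS hlen
  rcases List.infix_concat_iff.1 hS with h2 | h2
  · rcases List.suffix_concat_iff.1 h2 with rfl | ⟨t, rfl, ht⟩
    · simp at hlen; omega
    · exact h t ht (by simpa using hlen)
  · exact hK S h2 hlen

theorem span_kill {k : ℕ} {s : Set (Fin k → ℤ)} {f : (Fin k → ℤ) →ₗ[ℤ] ℤ}
    (h : ∀ x ∈ s, f x = 0) {u : Fin k → ℤ} (hu : u ∈ Submodule.span ℤ s) : f u = 0 := by
  have : Submodule.span ℤ s ≤ LinearMap.ker f := Submodule.span_le.2 fun x hx => h x hx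
  exact this hu

theorem ldet_core {k : ℕ} (p : ℤ) (Z B : List (Fin k → ℤ)) (b : Fin k → ℤ) (q : ℕ)
    (hq : B.length + q = k) (hZ : 2 * q ≤ Z.length)
    (h1 : ∀ S, S <:+: Z → S.length = q → ldet (B ++ S) = 1)
    (h2 : ∀ S, S <:+: Z → S.length + 1 = q → p ∣ ldet (B ++ b :: S))
    (C : List (Fin k → ℤ)) : p ∣ ldet (C ++ (B ++ [b])) := by
  have hU : ∀ r, r ≤ q → ∃ w : Fin k → ℤ,
      b - p • w ∈ Submodule.span ℤ {x | x ∈ B ∨ x ∈ (Z.take q).drop r} := by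
    intro r
    induction r with
    | zero =>
      intro _
      refine ⟨0, ?_⟩
      have hl : (B ++ Z.take q).length = k := by simp; omega
      have hc := ldet_cramer hl b
      rw [h1 _ (List.take_prefix _ _).isInfix (by simp; omega), one_smul] at hc
      rw [smul_zero, sub_zero, hc]
      refine Submodule.sum_mem _ fun i _ => Submodule.smul_mem _ _ (Submodule.subset_span ?_)
      have hi : (i : ℕ) < (B ++ Z.take q).length := by rw [hl]; exact i.2
      rw [List.getD_eq_getElem _ _ hi]
      exact List.mem_append.1 (List.getElem_mem hi)
    | succ r ih =>
      intro hr
      obtain ⟨w, hw⟩ := ih (by omega)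
      have hrZ : r < Z.length := by omega
      have hrq : r < (Z.take q).length := by simp; omega
      have hcons : (Z.take q).drop r = Z[r] :: (Z.take q).drop (r + 1) := by
        rw [List.drop_eq_getElem_cons hrq]; simp
      have hset : {x | x ∈ B ∨ x ∈ (Z.take q).drop r} =
          insert Z[r] {x | x ∈ B ∨ x ∈ (Z.take q).drop (r + 1)} := by
        rw [hcons]; ext x; simp only [Set.mem_ofPred_eq, List.mem_cons, Set.mem_insert_iff]; tauto
      rw [hset, Submodule.mem_span_insert] at hw
      obtain ⟨a, u, hu, hau⟩ := hw
      set S := (Z.drop (r + 1)).take (q - 1) with hS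
      have hSinf : S <:+: Z :=
        (List.take_prefix _ _).isInfix.trans (List.drop_suffix _ _).isInfix
      have hSlen : S.length + 1 = q := by rw [hS]; simp; omega
      have hzS : Z[r] :: S = (Z.drop r).take q := by
        rw [List.drop_eq_getElem_cons hrZ, ← hSlen, List.take_succ_cons, hS, ← hSlen]
        simp
      obtain ⟨f, hf⟩ := ldet_slot B S
      have hfz : f Z[r] = 1 := by
        rw [hf, hzS]
        apply h1
        · exact (List.take_prefix _ _).isInfix.trans (List.drop_suffix _ _).isInfix
        · simp; omega
      have hfb : p ∣ f b := by rw [hf]; exact h2 S hSinf hSlen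
      have hfu : f u = 0 := by
        refine span_kill ?_ hu
        rintro x (hx | hx)
        · rw [hf]; apply ldet_dup; intro hn
          exact (List.nodup_append.1 hn).2.2 x hx x (by simp) rfl
        · have hxS : x ∈ S := by
            rw [List.drop_take] at hx
            exact (List.take_prefix_take_left (by omega)).subset hx
          rw [hf]; apply ldet_dup; intro hn
          exact (List.nodup_cons.1 (List.nodup_append.1 hn).2.1).1 hxS
      have hfa := congrArg f hau
      rw [map_sub, map_smul, map_add, map_smul, hfz, hfu] at hfa
      simp only [smul_eq_mul, mul_one, add_zero] at hfa
      obtain ⟨a', rfl⟩ : p ∣ a := by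
        rw [← hfa]; exact dvd_sub hfb (Dvd.intro _ rfl)
      refine ⟨w + a' • Z[r], ?_⟩
      have : b - p • (w + a' • Z[r]) = u := by
        rw [smul_add, smul_smul, ← sub_sub, hau]; simp
      rw [this]; exact hu
  obtain ⟨w, hw⟩ := hU q le_rfl
  obtain ⟨f, hf⟩ := ldet_slot (C ++ B) []
  have : f (b - p • w) = 0 := by
    refine span_kill ?_ hw
    rintro x (hx | hx)
    · rw [hf]; apply ldet_dup; intro hn
      exact (List.nodup_append.1 hn).2.2 x (by simp [hx]) x (by simp) rfl
    · rw [List.drop_eq_nil_of_le (by simp)] at hx; simp at hx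
  rw [map_sub, map_smul, sub_eq_zero, hf] at this
  rw [← List.append_assoc, this]
  exact Dvd.intro _ rfl

/-- valid extension by appending -/
def Good {k : ℕ} (L Y : List (Fin k → ℤ)) : Prop :=
  LPos (L ++ Y) ∧ Win (L.drop (L.length - k + 1) ++ Y) ∧
    Sat ((L ++ Y).drop ((L ++ Y).length - k + 1))

theorem good_step {k : ℕ} {L Y : List (Fin k → ℤ)} (h1 : 1 ≤ k) (hk : k ≤ L.length)
    (hG : Good L Y) : ∃ y, Good L (Y ++ [y]) ∧
      ∀ i, 1 ≤ i → i < k → W i (L ++ (Y ++ [y])) ≤ W i (L ++ Y) := by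
  obtain ⟨hpos, hwin, hsat⟩ := hG
  have hk' : k ≤ (L ++ Y).length := by simp; omega
  obtain ⟨y, φ, g, hp, hW, hφ, hφ0, hg, hWg⟩ := exists_step h1 hk' hpos
  obtain rfl := step_one h1 hk' hsat φ g hg hWg
  have hW0 := hWg y
  rw [hφ, one_mul, W_snoc hk' (by omega)] at hW0
  simp only [List.take_zero, List.nil_append, Nat.add_zero] at hW0
  simp only [List.append_assoc] at hp hW
  refine ⟨y, ⟨hp, ?_, ?_⟩, hW⟩
  · rw [← List.append_assoc]
    refine win_snoc h1 hwin fun t ht hlen => ?_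
    have ht' : t <:+ L ++ Y := by
      refine ht.trans ⟨L.take (L.length - k + 1), ?_⟩
      rw [← List.append_assoc, List.take_append_drop]
    rw [List.suffix_iff_eq_drop] at ht'
    rw [ht', show (L ++ Y).length - t.length = (L ++ Y).length - k + 1 by omega]
    exact hW0
  · refine (sat_of_ldet_one hW0).mono ?_
    rw [← List.append_assoc, ← List.drop_append_of_le_length (by omega)]
    apply List.drop_sublist_drop_left
    simp; omega

theorem gap_close {k : ℕ} {L : List (Fin k → ℤ)} (h1 : 1 ≤ k) (hk : k ≤ L.length)
    (hL : LPos L) (hs : Sat (L.drop (L.length - k + 1))) (m : ℕ) (hm : m < k)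
    (hsm : Sat (L.take m)) :
    ∃ Y, Good L Y ∧ ∀ i, 1 ≤ i → i ≤ m → W i (L ++ Y) = 1 := by
  classical
  have hG0 : Good L [] := by
    refine ⟨by simpa using hL, ?_, by simpa using hs⟩
    intro S hS hlen
    have := hS.length_le
    simp at this; omega
  let Φ : List (Fin k → ℤ) → ℤ := fun Y => ∑ i ∈ Finset.Ico 1 k, W i (L ++ Y)
  have hΦ0 : ∀ Y, Good L Y → 0 ≤ Φ Y := fun Y hY => Finset.sum_nonneg fun i hi =>
    (W_pos (by simp; omega) (Finset.mem_Ico.1 hi).2.le hY.1).le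
  have hex : ∃ n : ℕ, ∃ Y, Good L Y ∧ (Φ Y).toNat = n := ⟨_, [], hG0, rfl⟩
  obtain ⟨Y0, hY0, hn⟩ := Nat.find_spec hex
  have hmin : ∀ Y, Good L Y → Φ Y0 ≤ Φ Y := by
    intro Y hY
    have h2 := Nat.find_min' hex ⟨Y, hY, rfl⟩
    have := hΦ0 Y hY
    have := hΦ0 Y0 hY0
    omega
  have hZ : ∀ N : ℕ, ∃ Z, Z.length = N ∧ Good L (Y0 ++ Z) ∧
      ∀ Z', Z' <+: Z → ∀ i, 1 ≤ i → i < k → W i (L ++ (Y0 ++ Z')) = W i (L ++ Y0) := by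
    intro N
    induction N with
    | zero =>
      refine ⟨[], rfl, by simpa using hY0, ?_⟩
      intro Z' hZ' i _ _
      rw [List.prefix_nil] at hZ'
      simp [hZ']
    | succ N ih =>
      obtain ⟨Z, hlen, hg, hpre⟩ := ih
      obtain ⟨y, hgy, hle⟩ := good_step h1 hk hg
      rw [List.append_assoc] at hgy hle
      refine ⟨Z ++ [y], by simp [hlen], hgy, ?_⟩
      intro Z' hZ' i hi1 hi2
      rcases List.prefix_concat_iff.1 hZ' with rfl | hZ'
      · have hle' : ∀ j ∈ Finset.Ico 1 k, W j (L ++ (Y0 ++ (Z ++ [y]))) ≤ W j (L ++ Y0) := by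
          intro j hj
          rw [Finset.mem_Ico] at hj
          rw [← hpre Z (List.prefix_refl _) j hj.1 hj.2]
          exact hle j hj.1 hj.2
        have hsum : ∑ j ∈ Finset.Ico 1 k, W j (L ++ (Y0 ++ (Z ++ [y]))) =
            ∑ j ∈ Finset.Ico 1 k, W j (L ++ Y0) :=
          le_antisymm (Finset.sum_le_sum hle') (hmin _ hgy)
        exact (Finset.sum_eq_sum_iff_of_le hle').1 hsum i (Finset.mem_Ico.2 ⟨hi1, hi2⟩)
      · exact hpre Z' hZ' i hi1 hi2
  obtain ⟨Z, hZlen, hZg, hZpre⟩ := hZ (2 * k)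
  -- windows formed with an infix of Z
  have hwz : ∀ i, 1 ≤ i → i < k → ∀ S, S <:+: Z → S.length + i = k →
      ldet (L.take i ++ S) = W i (L ++ Y0) := by
    intro i hi1 hi2 S hS hlen
    obtain ⟨s, t, hst⟩ := hS
    rw [← hZpre (s ++ S) ⟨t, hst⟩ i hi1 hi2, W, List.take_append_of_le_length (by omega)]
    congr 2
    have : S <:+ L ++ (Y0 ++ (s ++ S)) := ⟨L ++ (Y0 ++ s), by simp⟩
    rw [List.suffix_iff_eq_drop] at this
    refine this.trans ?_
    congr 1
    simp; omega
  have hone : ∀ i, 1 ≤ i → i ≤ m → W i (L ++ Y0) = 1 := by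
    intro i
    induction i with
    | zero => intro h; omega
    | succ j ih =>
      intro _ hjm
      have hjL : j < L.length := by omega
      have hB1 : ∀ S, S <:+: Z → S.length = k - j → ldet (L.take j ++ S) = 1 := by
        intro S hS hlen
        rcases Nat.eq_zero_or_pos j with rfl | hj
        · rw [List.take_zero, List.nil_append]
          refine hZg.2.1 S (hS.trans ?_) (by omega)
          exact ⟨L.drop (L.length - k + 1) ++ Y0, [], by simp⟩
        · rw [hwz j hj (by omega) S hS (by omega)]
          exact ih hj (by omega)
      have hWpos : 0 < W (j + 1) (L ++ Y0) := W_pos (by simp; omega) (by omega) hY0.1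
      have htake : L.take (j + 1) = L.take j ++ [L[j]] := by
        rw [List.take_append_getElem hjL]
      by_contra hne
      obtain ⟨p, hp, hpd⟩ := Nat.exists_prime_and_dvd (n := (W (j + 1) (L ++ Y0)).natAbs)
        (by omega)
      have hsj : Sat (L.take (j + 1)) :=
        hsm.mono (List.take_prefix_take_left hjm).sublist
      obtain ⟨C, hC⟩ := hsj p hp
      apply hC
      rw [htake]
      refine ldet_core p Z (L.take j) L[j] (k - j) (by simp; omega) (by omega) hB1 ?_ C
      intro S hS hlen
      have := hwz (j + 1) (by omega) (by omega) S hS (by omega)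
      rw [htake, List.append_assoc, List.singleton_append] at this
      rw [this]
      exact Int.natCast_dvd.2 hpd
  exact ⟨Y0, hY0, hone⟩

theorem win_append {k : ℕ} {O : List (Fin k → ℤ)} (h1 : 1 ≤ k) (hO : Win O)
    (hlen : k ≤ O.length + 1) (Y : List (Fin k → ℤ))
    (hY : Win (O.drop (O.length + 1 - k) ++ Y)) : Win (O ++ Y) := by
  induction Y using List.reverseRecOn with
  | nil => simpa using hO
  | append_singleton Y y ih =>
    rw [← List.append_assoc]
    refine win_snoc h1 (ih ?_) ?_
    · intro S hS hk
      refine hY S (hS.trans ?_) hk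
      rw [← List.append_assoc]
      exact (List.prefix_append _ _).isInfix
    · intro t ht hk
      have h2 : O.drop (O.length + 1 - k) ++ Y <:+ O ++ Y :=
        ⟨O.take (O.length + 1 - k), by rw [← List.append_assoc, List.take_append_drop]⟩
      have h3 : t <:+ O.drop (O.length + 1 - k) ++ Y :=
        List.suffix_of_suffix_length_le ht h2 (by simp; omega)
      refine hY _ ?_ (by simpa using hk)
      obtain ⟨s, hs⟩ := h3
      exact ⟨s, [], by rw [← List.append_assoc _ Y, ← hs]; simp⟩

/-- the twisting sign -/
def sg (k : ℕ) : ℤ := (-1) ^ (k - 1)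

theorem sg_sq (k : ℕ) : sg k * sg k = 1 := by
  rw [sg, ← pow_add, ← two_mul, pow_mul]; simp

theorem sg_pow (k : ℕ) : sg k ^ k = 1 := by
  rw [sg, ← pow_mul, mul_comm]
  exact (Nat.even_mul_pred_self k).neg_one_pow

theorem ldet_rot {k : ℕ} (S : List (Fin k → ℤ)) (h : Fin k → ℤ) (hS : S.length + 1 = k) :
    ldet (S ++ [sg k • h]) = ldet (h :: S) := by
  obtain ⟨f, hf⟩ := ldet_slot S []
  rw [← hf, map_smul, hf]
  have := ldet_move [] S [] h
  simp only [List.nil_append, List.append_nil] at this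
  rw [this, sg, show k - 1 = S.length by omega, smul_eq_mul]

theorem ldet_map_sg {k : ℕ} (l : List (Fin k → ℤ)) :
    ldet (l.map (sg k • ·)) = ldet l := by
  by_cases h : l.length = k
  · rw [ldet, ldet, if_pos (by simpa using h), if_pos h, colDet, colDet]
    have : (Matrix.of fun r s : Fin k => (l.map (sg k • ·)).getD s 0 r) =
        sg k • (Matrix.of fun r s : Fin k => l.getD s 0 r) := by
      ext r s
      have hs : (s : ℕ) < l.length := by omega
      simp [hs]
    rw [this, Matrix.det_smul, Fintype.card_fin, sg_pow, one_mul]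
  · rw [ldet_of_ne h, ldet_of_ne (by simpa using h)]

theorem map_sg_sg {k : ℕ} (l : List (Fin k → ℤ)) :
    (l.map (sg k • ·)).map (sg k • ·) = l := by
  rw [List.map_map]
  conv_rhs => rw [← List.map_id l]
  congr 1
  funext v
  change sg k • sg k • v = v
  rw [smul_smul, sg_sq, one_smul]

/-- SL_k-frieze condition for a list -/
def Frieze {k : ℕ} (Y : List (Fin k → ℤ)) : Prop :=
  k ≤ Y.length ∧ LPos Y ∧ Win Y ∧
    ∀ P M Q, Y = P ++ (M ++ Q) → P.length + Q.length = k → ldet (P ++ Q) = 1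

theorem lpos_rot {k : ℕ} {h : Fin k → ℤ} {T : List (Fin k → ℤ)} (hp : LPos (h :: T)) :
    LPos (T ++ [sg k • h]) := by
  intro l hl hk
  obtain ⟨A, B, rfl, hA, hB⟩ := List.sublist_append_iff.1 hl
  rcases List.sublist_singleton.1 hB with rfl | rfl
  · rw [List.append_nil] at hk ⊢
    exact hp _ (hA.cons h) hk
  · rw [ldet_rot A h (by simpa using hk)]
    exact hp _ (hA.cons_cons h) (by simpa using hk)

theorem frieze_rot {k : ℕ} (h1 : 1 ≤ k) {h : Fin k → ℤ} {T : List (Fin k → ℤ)}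
    (hF : Frieze (h :: T)) : Frieze (T ++ [sg k • h]) := by
  obtain ⟨hlen, hp, hw, hc⟩ := hF
  have hw' : Win (T ++ [sg k • h]) := by
    refine win_snoc h1 ?_ ?_
    · intro S hS hk
      exact hw S (hS.trans (List.suffix_cons h T).isInfix) hk
    · intro t ht hk
      rw [ldet_rot t h hk]
      obtain ⟨s, hs⟩ := ht
      exact hc [h] s t (by simp [hs]) (by simp; omega)
  refine ⟨by simpa using hlen, lpos_rot hp, hw', ?_⟩
  intro P M Q hPQ hk
  rcases List.eq_nil_or_concat Q with rfl | ⟨Q', a, rfl⟩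
  · rw [List.append_nil]
    refine hw' P ?_ (by simpa using hk)
    rw [hPQ]
    exact (List.prefix_append _ _).isInfix
  · rw [List.concat_eq_append] at hPQ hk ⊢
    rw [← List.append_assoc, ← List.append_assoc] at hPQ
    obtain ⟨rfl, ha⟩ := List.append_inj' hPQ rfl
    obtain rfl := List.singleton_inj.1 ha
    rw [← List.append_assoc, ldet_rot _ _ (by simp at hk ⊢; omega)]
    exact hc (h :: P) M Q' (by simp) (by simp at hk ⊢; omega)

theorem frieze_rotate {k : ℕ} (h1 : 1 ≤ k) (A : List (Fin k → ℤ)) : ∀ B : List (Fin k → ℤ),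
    Frieze (A ++ B) → Frieze (B ++ A.map (sg k • ·)) := by
  induction A with
  | nil => intro B h; simpa using h
  | cons a A ih =>
    intro B h
    rw [List.cons_append] at h
    have := frieze_rot h1 h
    rw [List.append_assoc] at this
    simpa using ih _ this

theorem frieze_scale {k : ℕ} {L : List (Fin k → ℤ)} (hF : Frieze L) :
    Frieze (L.map (sg k • ·)) := by
  obtain ⟨hlen, hp, hw, hc⟩ := hF
  refine ⟨by simpa using hlen, ?_, ?_, ?_⟩
  · intro l hl hk
    rw [← ldet_map_sg]
    refine hp _ ?_ (by simpa using hk)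
    have := hl.map (sg k • ·)
    rwa [map_sg_sg] at this
  · intro l hl hk
    rw [← ldet_map_sg]
    refine hw _ ?_ (by simpa using hk)
    have := hl.map (sg k • ·)
    rwa [map_sg_sg] at this
  · intro P M Q hPQ hk
    rw [← ldet_map_sg, List.map_append]
    refine hc _ (M.map (sg k • ·)) _ ?_ (by simpa using hk)
    have := congrArg (List.map (sg k • ·)) hPQ
    rw [map_sg_sg] at this
    simpa using this

/-- extends to a frieze -/
def FExt {k : ℕ} (X : List (Fin k → ℤ)) : Prop := ∃ Y, Frieze Y ∧ X.Sublist Y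

theorem ext_rot {k : ℕ} (h1 : 1 ≤ k) {h : Fin k → ℤ} {T : List (Fin k → ℤ)}
    (hE : FExt (T ++ [sg k • h])) : FExt (h :: T) := by
  obtain ⟨Y, hY, hs⟩ := hE
  obtain ⟨r1, r2, rfl, ht, hh⟩ := List.append_sublist_iff.1 hs
  obtain ⟨s, t, rfl⟩ := List.append_of_mem (List.singleton_sublist.1 hh)
  rw [← List.append_assoc] at hY
  have := frieze_scale (frieze_rotate h1 _ _ hY)
  rw [List.map_append, map_sg_sg, List.map_cons, smul_smul, sg_sq, one_smul] at this
  refine ⟨_, this, ?_⟩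
  rw [List.cons_append]
  refine List.Sublist.cons_cons h ?_
  exact (ht.trans (List.sublist_append_left _ _)).trans (List.sublist_append_right _ _)

theorem main_aux {k : ℕ} (h2 : 2 ≤ k) : ∀ (N : ℕ) (I O : List (Fin k → ℤ)), I.length = N →
    k ≤ (I ++ O).length → LPos (I ++ O) → k ≤ O.length + 1 → Win O → Sat (O.take (k - 1)) →
    Sat (O.drop (O.length + 1 - k)) → (∀ x ∈ I, Sat [x]) → FExt (I ++ O) := by
  intro N
  induction N with
  | zero =>
    intro I O hN hk hp hkO hw hs1 hs2 _
    obtain rfl := List.length_eq_zero_iff.1 hN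
    rw [List.nil_append] at hk hp ⊢
    rw [show O.length + 1 - k = O.length - k + 1 by omega] at hs2
    obtain ⟨Y, hG, hW⟩ := gap_close (by omega) hk hp hs2 (k - 1) (by omega) hs1
    have hwin : Win (O ++ Y) := win_append (by omega) hw hkO Y (by
      rw [show O.length + 1 - k = O.length - k + 1 by omega]; exact hG.2.1)
    refine ⟨O ++ Y, ⟨by simp; omega, hG.1, hwin, ?_⟩, List.sublist_append_left _ _⟩
    intro P M Q hPQ hlen
    rcases Nat.eq_zero_or_pos P.length with h | h
    · obtain rfl := List.length_eq_zero_iff.1 h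
      refine hwin _ ?_ (by simpa using hlen)
      rw [hPQ]
      exact ⟨M, [], by simp⟩
    rcases Nat.eq_zero_or_pos Q.length with h' | h'
    · obtain rfl := List.length_eq_zero_iff.1 h'
      refine hwin _ ?_ (by simpa using hlen)
      rw [hPQ]
      exact ⟨[], M, by simp⟩
    have := hW P.length h (by omega)
    rw [W, hPQ] at this
    rw [← this]
    congr 2
    · simp
    · rw [show (P ++ (M ++ Q)).length - k + P.length = (P ++ M).length by simp; omega,
        ← List.append_assoc, List.drop_left]
  | succ N ih =>
    intro I O hN hk hp hkO hw hs1 hs2 hI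
    cases I with
    | nil => simp at hN
    | cons b I =>
      have hdrop : (b :: I ++ O).drop ((b :: I ++ O).length - k + 1) =
          O.drop (O.length + 1 - k) := by
        rw [show (b :: I ++ O).length - k + 1 = (b :: I).length + (O.length + 1 - k) by
          simp at hk ⊢; omega, ← List.drop_drop, List.drop_left]
      obtain ⟨Y, hG, hW⟩ := gap_close (by omega) hk hp (by rw [hdrop]; exact hs2) 1 (by omega)
        (by simpa using hI b (by simp))
      obtain ⟨hGp, hGw, hGs⟩ := hG
      rw [hdrop] at hGw
      have hwin : Win (O ++ Y) := win_append (by omega) hw hkO Y hGw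
      have hW1 := hW 1 le_rfl le_rfl
      have hlast : ∀ t, t <:+ O ++ Y → t.length + 1 = k → ldet (t ++ [sg k • b]) = 1 := by
        intro t ht hlen
        rw [ldet_rot t b hlen, ← hW1, W]
        have h3 : t <:+ b :: I ++ O ++ Y := by
          rw [List.append_assoc]
          exact ht.trans (List.suffix_append _ _)
        rw [List.suffix_iff_eq_drop] at h3
        rw [← List.singleton_append]
        congr 2
        refine h3.trans ?_
        congr 1
        simp at hk ⊢; omega
      have hwin' : Win (O ++ Y ++ [sg k • b]) := win_snoc (by omega) hwin hlast
      have hE : FExt (I ++ (O ++ Y ++ [sg k • b])) := by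
        refine ih I _ (by simpa using hN) (by simp at hk ⊢; omega) ?_ (by simp; omega) hwin' ?_ ?_
          (fun x hx => hI x (by simp [hx]))
        · have := lpos_rot (h := b) (T := I ++ (O ++ Y)) (by simpa using hGp)
          simpa using this
        · rw [List.append_assoc, List.take_append_of_le_length (by omega)]
          exact hs1
        · have hl : k ≤ (O ++ Y ++ [sg k • b]).length := by simp; omega
          have h4 := hwin' ((O ++ Y ++ [sg k • b]).drop ((O ++ Y ++ [sg k • b]).length - k))
            (List.drop_suffix _ _).isInfix (by rw [List.length_drop]; omega)
          refine (sat_of_ldet_one h4).mono ?_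
          apply List.drop_sublist_drop_left
          omega
      have hE' : FExt (b :: (I ++ (O ++ Y))) := by
        apply ext_rot (by omega)
        simpa using hE
      obtain ⟨Y', hY', hs⟩ := hE'
      refine ⟨Y', hY', List.Sublist.trans ?_ hs⟩
      rw [List.cons_append]
      refine List.Sublist.cons_cons b ?_
      exact (List.Sublist.refl I).append (List.sublist_append_left _ _)

theorem flag_exists {k : ℕ} {I : List (Fin k → ℤ)} {x : Fin k → ℤ} (h1 : 1 ≤ k)
    (hk : k ≤ (I ++ [x]).length) (hp : LPos (I ++ [x])) (hx : Sat [x]) :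
    ∀ j, j + 2 ≤ k → ∃ C, C.length = j ∧ LPos (I ++ x :: C) ∧ Sat (x :: C) := by
  intro j
  induction j with
  | zero => intro _; exact ⟨[], rfl, hp, hx⟩
  | succ j ih =>
    intro hj
    obtain ⟨C, hC, hpC, hsC⟩ := ih (by omega)
    have hk' : k ≤ (I ++ x :: C).length := by simp at hk ⊢; omega
    obtain ⟨y, φ, g, hpy, _, hφ, hφ0, _, _⟩ := exists_step h1 hk' hpC
    refine ⟨C ++ [y], by simp [hC], by simpa using hpy, ?_⟩
    rw [← List.cons_append]
    refine sat_snoc hsC y φ ?_ hφ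
    intro v hv
    apply hφ0
    have h3 : (x :: C) <:+ (I ++ x :: C).drop ((I ++ x :: C).length - k + 1) :=
      List.suffix_of_suffix_length_le (List.suffix_append _ _) (List.drop_suffix _ _)
        (by rw [List.length_drop, List.length_cons]; omega)
    exact h3.subset hv

theorem ext_of_pos {k : ℕ} (h2 : 2 ≤ k) (X : List (Fin k → ℤ)) (hk : k ≤ X.length)
    (hp : LPos X) (hX : ∀ x ∈ X, Sat [x]) : FExt X := by
  rcases List.eq_nil_or_concat X with rfl | ⟨I, x, rfl⟩
  · simp at hk; omega
  rw [List.concat_eq_append] at *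
  obtain ⟨C, hC, hpC, hsC⟩ := flag_exists (by omega) hk hp (hX x (by simp)) (k - 2) (by omega)
  have hl : (x :: C).length + 1 = k := by simp; omega
  obtain ⟨Y, hY, hs⟩ := main_aux h2 I.length I (x :: C) rfl (by simp at hk ⊢; omega) hpC (by omega)
    (by intro S hS hlen; have := hS.length_le; omega)
    (hsC.mono (List.take_sublist _ _)) (hsC.mono (List.drop_sublist _ _))
    (fun v hv => hX v (by simp [hv]))
  refine ⟨Y, hY, List.Sublist.trans ?_ hs⟩
  exact (List.Sublist.refl I).append (by simp)

theorem lpos_ofFn {k n : ℕ} (x : Fin n → (Fin k → ℤ))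
    (hpos : ∀ f : Fin k → Fin n, StrictMono f → 0 < colDet (fun s => x (f s))) :
    LPos (List.ofFn x) := by
  intro l hl hk
  obtain ⟨f, hf⟩ := List.sublist_iff_exists_fin_orderEmbedding_get_eq.1 hl
  have h := hpos (fun s => Fin.cast (by simp) (f (Fin.cast hk.symm s))) (by
    intro a b hab
    have : f (Fin.cast hk.symm a) < f (Fin.cast hk.symm b) := f.strictMono hab
    exact this)
  rw [ldet, if_pos hk]
  convert h using 2
  funext s
  have h2 := hf (Fin.cast hk.symm s)
  rw [List.getD_eq_getElem _ _ (by omega)]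
  simp only [List.get_eq_getElem, List.getElem_ofFn, Fin.val_cast] at h2
  exact h2

theorem ofFn_sublist {k : ℕ} {Y : List (Fin k → ℤ)} (g : Fin k → Fin Y.length)
    (hg : StrictMono g) : (List.ofFn fun s => Y.get (g s)).Sublist Y := by
  rw [List.sublist_iff_exists_fin_orderEmbedding_get_eq]
  refine ⟨OrderEmbedding.ofStrictMono (fun i => g (Fin.cast (by simp) i)) ?_, ?_⟩
  · intro a b hab
    exact hg hab
  · intro i
    simp
    rfl

theorem frieze_window {k : ℕ} (h1 : 1 ≤ k) {Y : List (Fin k → ℤ)} (hF : Frieze Y)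
    (i : Fin Y.length) (g : Fin k → Fin Y.length) (hg : StrictMono g)
    (hr : Set.range g = {t : Fin Y.length | ∃ j : Fin k, (t : ℕ) = ((i : ℕ) + (j : ℕ)) % Y.length}) :
    colDet (fun s => Y.get (g s)) = 1 := by
  obtain ⟨hlen, hp, hw, hc⟩ := hF
  have hi := i.2
  rw [← ldet_ofFn]
  rcases Nat.lt_or_ge Y.length (i + k) with h | h
  · -- wrapping window
    obtain ⟨r, hrr⟩ : ∃ r, i + k = Y.length + r := ⟨i + k - Y.length, by omega⟩
    have hg0 : ∀ s : Fin k, (if (s : ℕ) < r then (s : ℕ) else s + (Y.length - k)) < Y.length := by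
      intro s
      have := s.2
      split_ifs <;> omega
    have hgeq : g = fun s : Fin k => ⟨_, hg0 s⟩ := by
      refine (StrictMono.range_inj hg ?_).1 ?_
      · intro a b hab
        have hab' : (a : ℕ) < b := hab
        simp only [Fin.lt_def]
        split_ifs <;> omega
      · rw [hr]
        ext t
        constructor
        · rintro ⟨j, hj⟩
          have hj2 := j.2
          rcases Nat.lt_or_ge (i + j) Y.length with h3 | h3
          · rw [Nat.mod_eq_of_lt h3] at hj
            refine ⟨⟨j + r, by omega⟩, Fin.ext ?_⟩
            simp only
            rw [if_neg (by omega)]; omega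
          · rw [Nat.mod_eq_sub_mod h3, Nat.mod_eq_of_lt (by omega)] at hj
            refine ⟨⟨i + j - Y.length, by omega⟩, Fin.ext ?_⟩
            simp only
            rw [if_pos (by omega)]; omega
        · rintro ⟨s, rfl⟩
          have hs := s.2
          rcases Nat.lt_or_ge (s : ℕ) r with h3 | h3
          · refine ⟨⟨s + Y.length - i, by omega⟩, ?_⟩
            simp only
            rw [if_pos h3, show (i : ℕ) + (s + Y.length - i) = s + Y.length by omega,
              Nat.add_mod_right, Nat.mod_eq_of_lt (by omega)]
          · refine ⟨⟨s - r, by omega⟩, ?_⟩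
            simp only
            rw [if_neg (by omega), Nat.mod_eq_of_lt (by omega)]; omega
    have hlist : (List.ofFn fun s => Y.get (g s)) = Y.take r ++ Y.drop (r + (Y.length - k)) := by
      apply List.ext_getElem
      · simp; omega
      · intro m hm1 hm2
        have hmk : m < k := by simpa using hm1
        subst hgeq
        simp only [List.getElem_ofFn, List.get_eq_getElem]
        by_cases h4 : m < r
        · rw [List.getElem_append_left (by simp; omega)]
          simp [h4]
        · rw [List.getElem_append_right (by simp; omega), List.getElem_drop]
          congr 1
          simp only [h4, if_false, List.length_take]
          omega
    rw [hlist]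
    refine hc _ ((Y.drop r).take (Y.length - k)) _ ?_ (by simp; omega)
    rw [← List.drop_drop, List.take_append_drop, List.take_append_drop]
  · have hgeq : g = fun s : Fin k => ⟨i + s, by omega⟩ := by
      refine (StrictMono.range_inj hg ?_).1 ?_
      · intro a b hab
        have hab' : (a : ℕ) < b := hab
        simp only [Fin.lt_def]
        omega
      · rw [hr]
        ext t
        constructor
        · rintro ⟨j, hj⟩
          rw [Nat.mod_eq_of_lt (by omega)] at hj
          exact ⟨j, Fin.ext hj.symm⟩
        · rintro ⟨j, rfl⟩
          exact ⟨j, by simp only; rw [Nat.mod_eq_of_lt (by omega)]⟩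
    have hlist : (List.ofFn fun s => Y.get (g s)) = (Y.drop i).take k := by
      apply List.ext_getElem
      · simp; omega
      · intro m hm1 hm2
        subst hgeq
        simp
    rw [hlist]
    exact hw _ ((List.take_prefix _ _).isInfix.trans (List.drop_suffix _ _).isInfix)
      (by simp; omega)

/-- Theorem `thm:slk`: let `x₁,…,x_n ∈ ℤ^k` with coprime entries
(`|x_i| = 1`) and with `det(x_{i₁} ⋯ x_{i_k}) > 0` for all increasing `k`-tuples.
Then there are `ℓ ≥ n`, vectors `y₁,…,y_ℓ ∈ ℤ^k` and indices `i₁ < … < i_n` such that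
`y_{i_r} = x_r`, all maximal minors of the `y`'s on increasing tuples are positive, and
for every cyclic window `[i, i+1, …, i+k−1]` (indices reduced modulo `ℓ`, columns sorted
ascending by reduced index) the determinant is `1`; i.e. the frieze with coefficients
extends to an `SL_k`-frieze pattern. -/
theorem stmt6 (k n : ℕ) (hk : 1 ≤ k) (hkn : k ≤ n)
    (x : Fin n → (Fin k → ℤ))
    (hgcd : ∀ i : Fin n, Finset.univ.gcd (x i) = 1)
    (hpos : ∀ f : Fin k → Fin n, StrictMono f → 0 < colDet (fun s => x (f s))) :
    ∃ ℓ : ℕ, n ≤ ℓ ∧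
      ∃ (y : Fin ℓ → (Fin k → ℤ)) (idx : Fin n → Fin ℓ),
        StrictMono idx ∧
        (∀ r : Fin n, y (idx r) = x r) ∧
        (∀ g : Fin k → Fin ℓ, StrictMono g → 0 < colDet (fun s => y (g s))) ∧
        (∀ i : Fin ℓ, ∀ g : Fin k → Fin ℓ, StrictMono g →
          (Set.range g = {t : Fin ℓ | ∃ j : Fin k, (t : ℕ) = ((i : ℕ) + (j : ℕ)) % ℓ}) →
          colDet (fun s => y (g s)) = 1) := by
  rcases Nat.lt_or_ge 1 k with h2 | h2
  · obtain ⟨Y, hY, hs⟩ := ext_of_pos h2 (List.ofFn x) (by simpa using hkn) (lpos_ofFn x hpos) (by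
      intro v hv
      obtain ⟨i, rfl⟩ := (List.mem_ofFn' _ _).1 hv
      exact sat_singleton _ (hgcd i))
    obtain ⟨f, hf⟩ := List.sublist_iff_exists_fin_orderEmbedding_get_eq.1 hs
    refine ⟨Y.length, by simpa using hs.length_le, Y.get,
      fun r => f (Fin.cast (by simp) r), ?_, ?_, ?_, ?_⟩
    · intro a b hab
      exact f.strictMono hab
    · intro r
      rw [← hf]; simp
    · intro g hg
      rw [← ldet_ofFn]
      exact hY.2.1 _ (ofFn_sublist g hg) (by simp)
    · intro i g hg hr
      exact frieze_window hk hY i g hg hr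
  · obtain rfl : k = 1 := by omega
    refine ⟨n, le_rfl, x, id, strictMono_id, fun _ => rfl, hpos, ?_⟩
    intro i g hg _
    have h3 := hpos g hg
    have h4 := hgcd (g 0)
    have h5 : colDet (fun s => x (g s)) = x (g 0) 0 := by
      simp [colDet]
    rw [h5] at h3 ⊢
    have h6 : Finset.univ.gcd (x (g 0)) = |x (g 0) 0| := by
      simp [Int.abs_eq_normalize]
    rw [h6, abs_of_pos h3] at h4
    exact h4
end
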